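/- arXiv:1301.5297 — 4 statements merged into one kernel-verified Lean document; each statement's English description precedes it below -/
import Mathlib

section
/- Let 𝕀 = [0,1] and let D be a discrete space of cardinality at least non(M). Then the product 𝕀 × αD contains a closed subspace X that has weight equal to non(M) and is not supercompact. In particular, 𝕀 × αD is not hereditarily supercompact. -/
open Set Topology TopologicalSpace

universe u

/-- A topological space is *supercompact* if it has a subbase `S` for its topology such that
every cover of the space by members of `S` has a subcover with at most two members. -/
def IsSupercompact (X : Type*) [t : TopologicalSpace X] : Prop :=
  ∃ S : Set (Set X), TopologicalSpace.generateFrom S = t ∧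
    ∀ C ⊆ S, ⋃₀ C = univ → ∃ T ⊆ C, T.Finite ∧ T.ncard ≤ 2 ∧ ⋃₀ T = univ

/-- A topological space is *hereditarily supercompact* if each of its closed subspaces is
supercompact. -/
def IsHereditarilySupercompact (X : Type*) [TopologicalSpace X] : Prop :=
  ∀ Z : Set X, IsClosed Z → IsSupercompact Z

/-- `non(M)`: the smallest cardinality of a non-meager subset of the real line. -/
noncomputable def nonMeagerCard : Cardinal :=
  sInf {c : Cardinal | ∃ A : Set ℝ, ¬ IsMeagre A ∧ Cardinal.mk A = c}

/-- The weight of a topological space: the smallest cardinality of a base of its topology. -/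
noncomputable def topWeight (X : Type u) [TopologicalSpace X] : Cardinal.{u} :=
  sInf {c : Cardinal | ∃ B : Set (Set X), IsTopologicalBasis B ∧ Cardinal.mk B = c}

/-- A supercompact space has a family of closed sets such that any pairwise intersecting triple of
its members has a common point and such that finite unions of its members interpolate between closed
sets and their open neighbourhoods. -/
theorem IsSupercompact.exists_binary_family {X : Type*} [TopologicalSpace X] [CompactSpace X]
    (h : IsSupercompact X) :
    ∃ 𝓑 : Set (Set X), (∀ B ∈ 𝓑, IsClosed B) ∧
      (∀ P U : Set X, IsClosed P → IsOpen U → P ⊆ U →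
        ∃ 𝓕 ⊆ 𝓑, 𝓕.Finite ∧ P ⊆ ⋃₀ 𝓕 ∧ ⋃₀ 𝓕 ⊆ U) ∧
      ∀ B₁ ∈ 𝓑, ∀ B₂ ∈ 𝓑, ∀ B₃ ∈ 𝓑, (B₁ ∩ B₂).Nonempty → (B₁ ∩ B₃).Nonempty →
        (B₂ ∩ B₃).Nonempty → (B₁ ∩ (B₂ ∩ B₃)).Nonempty := by
  obtain ⟨S, hS, hcov⟩ := h
  have hSopen : ∀ s ∈ S, IsOpen s := fun s hs => hS ▸ isOpen_generateFrom_of_mem hs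
  refine ⟨{B | ∃ 𝓢 ⊆ S, B = (⋃₀ 𝓢)ᶜ}, ?_, ?_, ?_⟩
  · rintro _ ⟨𝓢, h𝓢, rfl⟩
    exact (isOpen_sUnion fun s hs => hSopen s (h𝓢 hs)).isClosed_compl
  · intro P U hP hU hPU
    have hbasis := isTopologicalBasis_of_subbasis hS.symm
    have hloc : ∀ y : X, y ∈ Uᶜ → ∃ f : Set (Set X), (f.Finite ∧ f ⊆ S) ∧ y ∈ ⋂₀ f ∧ ⋂₀ f ⊆ Pᶜ := by
      intro y hy
      obtain ⟨_, ⟨f, hf, rfl⟩, hyf, hfP⟩ :=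
        hbasis.exists_subset_of_mem_open (show y ∈ Pᶜ from fun hyP => hy (hPU hyP))
          hP.isOpen_compl
      exact ⟨f, hf, hyf, hfP⟩
    choose! f hf hyf hfP using hloc
    obtain ⟨t, htU, ht⟩ := hU.isClosed_compl.isCompact.elim_nhds_subcover (fun y => ⋂₀ f y)
      fun y hy => ((hf y hy).1.isOpen_sInter fun s hs => hSopen s ((hf y hy).2 hs)).mem_nhds
        (hyf y hy)
    have hfin : (⋃ y ∈ t, f y).Finite := t.finite_toSet.biUnion fun y hy => (hf y (htU y hy)).1
    have hsub : (⋃ y ∈ t, f y) ⊆ S := iUnion₂_subset fun y hy => (hf y (htU y hy)).2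
    refine ⟨{B | (∃ 𝓢 ⊆ ⋃ y ∈ t, f y, B = (⋃₀ 𝓢)ᶜ) ∧ B ⊆ U}, ?_, ?_, ?_, ?_⟩
    · rintro B ⟨⟨𝓢, h𝓢, rfl⟩, -⟩
      exact ⟨𝓢, h𝓢.trans hsub, rfl⟩
    · refine (hfin.finite_subsets.image fun 𝓢 : Set (Set X) => (⋃₀ 𝓢)ᶜ).subset ?_
      rintro B ⟨⟨𝓢, h𝓢, rfl⟩, -⟩
      exact ⟨𝓢, h𝓢, rfl⟩
    · intro x hx
      refine ⟨(⋃₀ {s ∈ ⋃ y ∈ t, f y | x ∉ s})ᶜ, ⟨⟨_, sep_subset _ _, rfl⟩, ?_⟩, ?_⟩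
      · intro w hw
        by_contra hwU
        obtain ⟨y, hy, hwy⟩ := mem_iUnion₂.1 (ht hwU)
        have hxf : x ∉ ⋂₀ f y := fun hxf => hfP y (htU y hy) hxf hx
        simp only [mem_sInter, not_forall] at hxf
        obtain ⟨s, hs, hxs⟩ := hxf
        exact hw ⟨s, ⟨mem_iUnion₂.2 ⟨y, hy, hs⟩, hxs⟩, hwy s hs⟩
      · rintro ⟨s, hs, hxs⟩
        exact hs.2 hxs
    · exact sUnion_subset fun B hB => hB.2
  · rintro _ ⟨𝓢₁, h₁, rfl⟩ _ ⟨𝓢₂, h₂, rfl⟩ _ ⟨𝓢₃, h₃, rfl⟩ h₁₂ h₁₃ h₂₃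
    by_contra hempty
    have hcover : ⋃₀ (𝓢₁ ∪ (𝓢₂ ∪ 𝓢₃)) = univ := by
      rw [← compl_empty_iff, sUnion_union, sUnion_union, compl_union, compl_union]
      exact not_nonempty_iff_eq_empty.1 hempty
    obtain ⟨T, hT, hTfin, hTcard, hTcov⟩ := hcov _ (union_subset h₁ (union_subset h₂ h₃)) hcover
    have hpair : ∀ s ∈ 𝓢₁ ∪ (𝓢₂ ∪ 𝓢₃), ∀ t ∈ 𝓢₁ ∪ (𝓢₂ ∪ 𝓢₃), ∃ z, z ∉ s ∧ z ∉ t := by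
      obtain ⟨x, hx₁, hx₂⟩ := h₁₂
      obtain ⟨y, hy₁, hy₃⟩ := h₁₃
      obtain ⟨w, hw₂, hw₃⟩ := h₂₃
      simp only [mem_compl_iff, mem_sUnion, not_exists, not_and] at *
      grind
    have hT2 : ∃ s ∈ 𝓢₁ ∪ (𝓢₂ ∪ 𝓢₃), ∃ t ∈ 𝓢₁ ∪ (𝓢₂ ∪ 𝓢₃), ⋃₀ T ⊆ s ∪ t := by
      have : T.ncard = 0 ∨ T.ncard = 1 ∨ T.ncard = 2 := by omega
      rcases this with h0 | h1 | h2
      · rw [Set.ncard_eq_zero hTfin] at h0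
        obtain ⟨x, -⟩ := h₁₂
        exact absurd (hTcov ▸ mem_univ x : x ∈ ⋃₀ T) (by simp [h0])
      · obtain ⟨s, rfl⟩ := Set.ncard_eq_one.1 h1
        exact ⟨s, hT rfl, s, hT rfl, by simp⟩
      · obtain ⟨s, t, -, rfl⟩ := Set.ncard_eq_two.1 h2
        exact ⟨s, hT (by simp), t, hT (by simp), by simp⟩
    obtain ⟨s, hs, t, ht, hst⟩ := hT2
    obtain ⟨z, hzs, hzt⟩ := hpair s hs t ht
    rw [hTcov] at hst
    rcases hst (mem_univ z) with hz | hz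
    exacts [hzs hz, hzt hz]

theorem exists_finite_cover_dist_lt {X M : Type*} [TopologicalSpace X] [PseudoMetricSpace M]
    [CompactSpace M] {𝓑 : Set (Set X)}
    (h𝓑 : ∀ P U : Set X, IsClosed P → IsOpen U → P ⊆ U →
      ∃ 𝓕 ⊆ 𝓑, 𝓕.Finite ∧ P ⊆ ⋃₀ 𝓕 ∧ ⋃₀ 𝓕 ⊆ U)
    {r : X → M} (hr : Continuous r) {ε : ℝ} (hε : 0 < ε) :
    ∃ 𝓣 ⊆ 𝓑, 𝓣.Finite ∧ ⋃₀ 𝓣 = univ ∧ ∀ T ∈ 𝓣, ∀ z ∈ T, ∀ w ∈ T, dist (r z) (r w) < ε := by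
  have hloc : ∀ x : M, ∃ 𝓕 ⊆ 𝓑, 𝓕.Finite ∧ r ⁻¹' Metric.closedBall x (ε / 3) ⊆ ⋃₀ 𝓕 ∧
      ⋃₀ 𝓕 ⊆ r ⁻¹' Metric.ball x (ε / 2) := fun x =>
    h𝓑 _ _ (Metric.isClosed_closedBall.preimage hr) (Metric.isOpen_ball.preimage hr)
      (preimage_mono (Metric.closedBall_subset_ball (by linarith)))
  choose 𝓕 h𝓕 hfin hcov hsub using hloc
  obtain ⟨t, -, ht⟩ := isCompact_univ.elim_nhds_subcover (fun x : M => Metric.closedBall x (ε / 3))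
    fun x _ => Metric.closedBall_mem_nhds x (by positivity)
  refine ⟨⋃ x ∈ t, 𝓕 x, iUnion₂_subset fun x _ => h𝓕 x,
    t.finite_toSet.biUnion fun x _ => hfin x, ?_, ?_⟩
  · refine eq_univ_of_forall fun z => ?_
    obtain ⟨x, hx, hzx⟩ := mem_iUnion₂.1 (ht (mem_univ (r z)))
    obtain ⟨T, hT, hzT⟩ := hcov x hzx
    exact ⟨T, mem_iUnion₂.2 ⟨x, hx, hT⟩, hzT⟩
  · intro T hT z hz w hw
    obtain ⟨x, -, hTx⟩ := mem_iUnion₂.1 hT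
    have h₁ : dist (r z) x < ε / 2 := hsub x ⟨T, hTx, hz⟩
    have h₂ : dist (r w) x < ε / 2 := hsub x ⟨T, hTx, hw⟩
    linarith [dist_triangle_right (r z) (r w) x]

/-- Points `y i ∈ t i` can be chosen such that each of them is a limit of points which
simultaneously avoid all the sets `t j` that share this choice. -/
theorem exists_mem_closure_compl_biUnion {M κ : Type*} [TopologicalSpace M] [PreconnectedSpace M]
    [Nonempty M] (t : κ → Set M) (C : Finset κ) (hclosed : ∀ i ∈ C, IsClosed (t i))
    (hne : ∀ i ∈ C, (t i).Nonempty) (hC : ⋃ i ∈ C, t i ≠ univ) :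
    ∃ y : κ → M, ∀ i ∈ C, y i ∈ t i ∧ y i ∈ closure (⋃ j ∈ C, ⋃ (_ : y j = y i), t j)ᶜ := by
  classical
  induction C using Finset.strongInduction with
  | H C ih =>
    rcases C.eq_empty_or_nonempty with rfl | ⟨i₀, hi₀⟩
    · exact ⟨fun _ => Classical.arbitrary M, by simp⟩
    have hUne : (⋃ i ∈ C, t i).Nonempty :=
      (hne i₀ hi₀).mono (subset_biUnion_of_mem (u := t) hi₀)
    have hUcl : IsClosed (⋃ i ∈ C, t i) := C.finite_toSet.isClosed_biUnion hclosed
    obtain ⟨p, hp⟩ := nonempty_frontier_iff.2 ⟨hUne, hC⟩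
    have hpU := hUcl.frontier_subset hp
    have hpc : p ∈ closure (⋃ i ∈ C, t i)ᶜ := by
      rw [closure_compl]
      exact hp.2
    obtain ⟨i₁, hi₁, hpi₁⟩ := mem_iUnion₂.1 hpU
    have hsub : C.filter (fun i => p ∉ t i) ⊆ C := Finset.filter_subset _ _
    obtain ⟨y, hy⟩ := ih (C.filter fun i => p ∉ t i)
      (Finset.filter_ssubset.2 ⟨i₁, hi₁, by simpa using hpi₁⟩) (fun i hi => hclosed i (hsub hi))
      (fun i hi => hne i (hsub hi))
      (fun h => hC (eq_univ_of_univ_subset (h ▸ biUnion_subset_biUnion_left hsub)))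
    refine ⟨fun i => if p ∈ t i then p else y i, fun i hi => ?_⟩
    by_cases hpi : p ∈ t i
    · simp only [hpi, if_true]
      refine ⟨trivial, closure_mono (compl_subset_compl.2 ?_) hpc⟩
      exact iUnion₂_mono fun j _ => iUnion_subset fun _ => subset_rfl
    · obtain ⟨h₁, h₂⟩ := hy i (Finset.mem_filter.2 ⟨hi, hpi⟩)
      simp only [hpi, if_false]
      refine ⟨h₁, closure_mono (compl_subset_compl.2 ?_) h₂⟩
      refine iUnion₂_subset fun j hj => iUnion_subset fun hji => ?_
      by_cases hpj : p ∈ t j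
      · rw [if_pos hpj] at hji
        exact absurd (hji ▸ h₁) hpi
      · rw [if_neg hpj] at hji
        exact subset_iUnion₂_of_subset j (Finset.mem_filter.2 ⟨hj, hpj⟩)
          (subset_iUnion_of_subset hji subset_rfl)

theorem exists_isOpen_subset_subset_or_disjoint {M κ : Type*} [TopologicalSpace M] (t : κ → Set M)
    {C : Set κ} (hC : C.Finite) (hclosed : ∀ i ∈ C, IsClosed (t i)) {O : Set M} (hO : IsOpen O)
    (hne : O.Nonempty) :
    ∃ O' ⊆ O, IsOpen O' ∧ O'.Nonempty ∧ ∀ i ∈ C, O' ⊆ t i ∨ Disjoint O' (t i) := by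
  induction C, hC using Set.Finite.induction_on with
  | empty => exact ⟨O, subset_rfl, hO, hne, by simp⟩
  | @insert i C _ _ ih =>
    obtain ⟨O', hO'O, hO', hne', h⟩ := ih fun j hj => hclosed j (mem_insert_of_mem _ hj)
    by_cases hi : O' ⊆ t i
    · exact ⟨O', hO'O, hO', hne', forall_mem_insert.2 ⟨Or.inl hi, h⟩⟩
    · refine ⟨O' \ t i, sdiff_subset.trans hO'O, hO'.sdiff (hclosed i (mem_insert _ _)),
        sdiff_nonempty.2 hi, forall_mem_insert.2 ⟨Or.inr disjoint_sdiff_left, fun j hj => ?_⟩⟩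
      exact (h j hj).imp sdiff_subset.trans fun hd => hd.mono_left sdiff_subset

theorem exists_nonempty_interior_of_subset_sUnion {X : Type*} [TopologicalSpace X]
    {𝓕 : Set (Set X)} (hfin : 𝓕.Finite) (hclosed : ∀ B ∈ 𝓕, IsClosed B) {O : Set X}
    (hO : IsOpen O) (hne : O.Nonempty) (hsub : O ⊆ ⋃₀ 𝓕) : ∃ B ∈ 𝓕, (interior B).Nonempty := by
  obtain ⟨O', hO'O, hO', ⟨x, hx⟩, h⟩ :=
    exists_isOpen_subset_subset_or_disjoint id hfin hclosed hO hne
  obtain ⟨B, hB, hxB⟩ := hsub (hO'O hx)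
  refine ⟨B, hB, x, interior_maximal ((h B hB).resolve_right fun hd => ?_) hO' hx⟩
  exact disjoint_left.1 hd hx hxB

theorem exists_pos_forall_le_dist {M κ : Type*} [MetricSpace M] {C : Set κ} (hC : C.Finite)
    (y : κ → M) : ∃ η > 0, ∀ i ∈ C, ∀ j ∈ C, y i ≠ y j → η ≤ dist (y i) (y j) := by
  have hfin : {p ∈ C ×ˢ C | y p.1 ≠ y p.2}.Finite := (hC.prod hC).subset (sep_subset _ _)
  rcases eq_empty_or_nonempty {p ∈ C ×ˢ C | y p.1 ≠ y p.2} with h | hne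
  · exact ⟨1, one_pos, fun i hi j hj hij =>
      (eq_empty_iff_forall_notMem.1 h (i, j) ⟨⟨hi, hj⟩, hij⟩).elim⟩
  · obtain ⟨p, hp, hmin⟩ := exists_min_image _ (fun p : κ × κ => dist (y p.1) (y p.2)) hfin hne
    exact ⟨_, dist_pos.2 hp.2, fun i hi j hj hij => hmin (i, j) ⟨⟨hi, hj⟩, hij⟩⟩

/-- A compact space fibred over a connected compact metric space `M`, with a section of the
projection to which infinitely many clopen levels accumulate, is not supercompact if the levels
can be pushed into arbitrary finite families of small open sets. -/
theorem not_isSupercompact_of_rich_levels {X M α : Type*} [TopologicalSpace X] [CompactSpace X]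
    [MetricSpace M] [CompactSpace M] [PreconnectedSpace M] [Nontrivial M] {r : X → M} {ι : M → X}
    (hr : Continuous r) (hι : Continuous ι) (hrι : ∀ x, r (ι x) = x) {L : α → Set X}
    (hL : ∀ a, IsClopen (L a)) (hLne : ∀ a, (L a).Nonempty)
    (hfin : ∀ (U : Set X) (K : Set M), IsOpen U → IsClosed K → ι '' K ⊆ U →
      {a | ∃ z ∈ L a, r z ∈ K ∧ z ∉ U}.Finite)
    (hrich : ∀ Q : α → Set X, (∀ a, IsOpen (Q a)) → (∀ a, (Q a).Nonempty) → (∀ a, Q a ⊆ L a) →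
      ∃ G : Set M, IsOpen G ∧ G.Nonempty ∧ ∀ 𝒲 : Set (Set M), 𝒲.Finite → 𝒲.Nonempty →
        (∀ W ∈ 𝒲, IsOpen W ∧ W.Nonempty ∧ W ⊆ G) → ∀ H, IsClosed H → H ⊆ G →
          {a | (∀ z ∈ L a, r z ∈ H → r z ∈ ⋃₀ 𝒲) ∧ ∀ W ∈ 𝒲, ∃ z ∈ Q a, r z ∈ W}.Infinite) :
    ¬ IsSupercompact X := by
  classical
  intro hX
  obtain ⟨𝓑, h𝓑closed, h𝓑approx, h𝓑binary⟩ := hX.exists_binary_family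
  have hpiece : ∀ a, ∃ B ∈ 𝓑, B ⊆ L a ∧ (interior B).Nonempty := by
    intro a
    obtain ⟨𝓕, h𝓕, h𝓕fin, hsub, hsup⟩ :=
      h𝓑approx (L a) (L a) (hL a).isClosed (hL a).isOpen subset_rfl
    obtain ⟨B, hB, hBne⟩ := exists_nonempty_interior_of_subset_sUnion h𝓕fin
      (fun B hB => h𝓑closed B (h𝓕 hB)) (hL a).isOpen (hLne a) hsub
    exact ⟨B, h𝓕 hB, (subset_sUnion_of_mem hB).trans hsup, hBne⟩
  choose B hB hBL hBne using hpiece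
  obtain ⟨G, hG, ⟨θ, hθ⟩, hrich⟩ := hrich (fun a => interior (B a)) (fun a => isOpen_interior)
    hBne fun a => interior_subset.trans (hBL a)
  obtain ⟨θ', hθ'⟩ := exists_ne θ
  obtain ⟨ρ, hρ, hρG⟩ := Metric.isOpen_iff.1 hG θ hθ
  obtain ⟨ε, hε, hερ, hεθ⟩ : ∃ ε > 0, 2 * ε < ρ ∧ 2 * ε < dist θ' θ :=
    ⟨min ρ (dist θ' θ) / 3, by have := dist_pos.2 hθ'; positivity,
      by linarith [min_le_left ρ (dist θ' θ)],
      by linarith [min_le_right ρ (dist θ' θ), dist_pos.2 hθ']⟩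
  have hHG : Metric.closedBall θ (2 * ε) ⊆ G := (Metric.closedBall_subset_ball hερ).trans hρG
  -- the coarse cover
  obtain ⟨𝓣, h𝓣, h𝓣fin, h𝓣cov, h𝓣dist⟩ := exists_finite_cover_dist_lt h𝓑approx hr hε
  have hclosed : ∀ T ∈ 𝓑, IsClosed (ι ⁻¹' T) := fun T hT => (h𝓑closed T hT).preimage hι
  obtain ⟨O, hOθ, hO, ⟨x, hxO⟩, hOdec⟩ := exists_isOpen_subset_subset_or_disjoint
    (fun T : Set X => ι ⁻¹' T) h𝓣fin (fun T hT => hclosed T (h𝓣 hT)) Metric.isOpen_ball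
    (Metric.nonempty_ball.2 hε : (Metric.ball θ ε).Nonempty)
  have hxθ : dist x θ < ε := hOθ hxO
  obtain ⟨δ, hδ, hδO⟩ := Metric.isOpen_iff.1 hO x hxO
  set C : Finset (Set X) := h𝓣fin.toFinset.filter fun T => ι x ∈ T with hCdef
  have hC : ∀ T, T ∈ C ↔ T ∈ 𝓣 ∧ ι x ∈ T := fun T => by simp [hCdef]
  have hnear : ∀ T ∈ C, ∀ z ∈ T, r z ∈ Metric.closedBall θ (2 * ε) := by
    intro T hT z hz
    have := h𝓣dist T ((hC T).1 hT).1 z hz (ι x) ((hC T).1 hT).2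
    rw [hrι] at this
    rw [Metric.mem_closedBall]
    linarith [dist_triangle (r z) x θ]
  have hCuniv : ⋃ T ∈ C, ι ⁻¹' T ≠ univ := by
    intro h
    obtain ⟨T, hT, hTθ⟩ := mem_iUnion₂.1 (h ▸ mem_univ θ' : θ' ∈ ⋃ T ∈ C, ι ⁻¹' T)
    have := hnear T hT _ hTθ
    rw [hrι, Metric.mem_closedBall] at this
    linarith
  have : Nonempty M := ⟨x⟩
  obtain ⟨y, hy⟩ := exists_mem_closure_compl_biUnion (fun T : Set X => ι ⁻¹' T) C
    (fun T hT => hclosed T (h𝓣 ((hC T).1 hT).1)) (fun T hT => ⟨x, ((hC T).1 hT).2⟩) hCuniv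
  have hyx : ∀ T ∈ C, δ ≤ dist x (y T) := by
    intro T hT
    by_contra! hlt
    have hyO : y T ∈ O := hδO (by rwa [Metric.mem_ball, dist_comm])
    obtain ⟨w, hwO, hw⟩ := mem_closure_iff.1 (hy T hT).2 O hO hyO
    refine hw (mem_iUnion₂.2 ⟨T, hT, mem_iUnion.2 ⟨rfl, ?_⟩⟩)
    exact (hOdec T ((hC T).1 hT).1).resolve_right
      (fun hd => disjoint_left.1 hd hxO ((hC T).1 hT).2) hwO
  obtain ⟨η₀, hη₀, hsep⟩ := exists_pos_forall_le_dist C.finite_toSet y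
  obtain ⟨η, hη, hηδ, hηη₀⟩ : ∃ η > 0, 3 * η ≤ δ ∧ 3 * η ≤ η₀ :=
    ⟨min δ η₀ / 3, by positivity, by linarith [min_le_left δ η₀], by linarith [min_le_right δ η₀]⟩
  -- the fine cover
  obtain ⟨𝓥, h𝓥, h𝓥fin, h𝓥cov, h𝓥dist⟩ := exists_finite_cover_dist_lt h𝓑approx hr hη
  have htarget : ∀ T ∈ C, ∃ W K : Set M, ∃ U : Set X, IsOpen W ∧ W.Nonempty ∧ W ⊆ K ∧
      IsClosed K ∧ IsOpen U ∧ ι '' K ⊆ U ∧ K ⊆ Metric.ball (y T) η ∧ K ⊆ G ∧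
      (∀ z ∈ U, ∀ T' ∈ C, y T' = y T → z ∉ T') ∧
      (∀ z ∈ U, ∀ V ∈ 𝓥, z ∈ V → ι (y T) ∈ V) := by
    intro T hT
    have hUcl₁ : IsClosed (⋃ T' ∈ C, ⋃ (_ : y T' = y T), T') :=
      C.finite_toSet.isClosed_biUnion fun T' hT' =>
        isClosed_iUnion_of_finite fun _ => h𝓑closed T' (h𝓣 ((hC T').1 hT').1)
    have hUcl₂ : IsClosed (⋃₀ {V ∈ 𝓥 | ι (y T) ∉ V}) := by
      rw [sUnion_eq_biUnion]
      exact (h𝓥fin.subset (sep_subset _ _)).isClosed_biUnion fun V hV => h𝓑closed V (h𝓥 hV.1)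
    have hUo := hUcl₁.isOpen_compl.inter hUcl₂.isOpen_compl
    have hyG : y T ∈ G := hHG (by simpa only [hrι] using hnear T hT _ (hy T hT).1)
    have hyN : y T ∈ ι ⁻¹' (⋃₀ {V ∈ 𝓥 | ι (y T) ∉ V})ᶜ ∩ (Metric.ball (y T) η ∩ G) :=
      ⟨fun ⟨V, hV, hyV⟩ => hV.2 hyV, Metric.mem_ball_self hη, hyG⟩
    have hNo := (hUcl₂.isOpen_compl.preimage hι).inter
      ((Metric.isOpen_ball (x := y T) (ε := η)).inter hG)
    obtain ⟨w, hwN, hw⟩ := mem_closure_iff.1 (hy T hT).2 _ hNo hyN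
    have hwU : ι w ∈ (⋃ T' ∈ C, ⋃ (_ : y T' = y T), T')ᶜ := by
      simpa only [mem_compl_iff, mem_iUnion, mem_preimage] using hw
    have hwU' : w ∈ ι ⁻¹' ((⋃ T' ∈ C, ⋃ (_ : y T' = y T), T')ᶜ ∩
        (⋃₀ {V ∈ 𝓥 | ι (y T) ∉ V})ᶜ) ∩ (Metric.ball (y T) η ∩ G) :=
      ⟨⟨hwU, hwN.1⟩, hwN.2⟩
    obtain ⟨K, hKnhds, hK, hKsub⟩ := exists_mem_nhds_isClosed_subset
      (((hUo.preimage hι).inter (Metric.isOpen_ball.inter hG)).mem_nhds hwU')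
    refine ⟨interior K, K, _, isOpen_interior, ⟨w, mem_interior_iff_mem_nhds.2 hKnhds⟩,
      interior_subset, hK, hUo, image_subset_iff.2 fun z hz => (hKsub hz).1,
      fun z hz => (hKsub hz).2.1, fun z hz => (hKsub hz).2.2, fun z hz T' hT' hTT' hzT' => ?_,
      fun z hz V hV hzV => ?_⟩
    · exact hz.1 (mem_iUnion₂.2 ⟨T', hT', mem_iUnion.2 ⟨hTT', hzT'⟩⟩)
    · by_contra hyV
      exact hz.2 ⟨V, ⟨hV, hyV⟩, hzV⟩
  choose! W K U hWo hWne hWK hK hUo hKU hKy hKG hUT hUV using htarget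
  have hU₀ : IsOpen (⋃₀ {T ∈ 𝓣 | ι x ∉ T})ᶜ := by
    rw [sUnion_eq_biUnion]
    exact ((h𝓣fin.subset (sep_subset _ _)).isClosed_biUnion fun T hT =>
      h𝓑closed T (h𝓣 hT.1)).isOpen_compl
  have hballO : Metric.closedBall x η ⊆ O :=
    (Metric.closedBall_subset_ball (by linarith)).trans hδO
  have hballU₀ : ι '' Metric.closedBall x η ⊆ (⋃₀ {T ∈ 𝓣 | ι x ∉ T})ᶜ := by
    rintro _ ⟨w, hw, rfl⟩ ⟨T, ⟨hT, hxT⟩, hwT⟩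
    rcases hOdec T hT with h | h
    · exact hxT (h hxO)
    · exact disjoint_left.1 h (hballO hw) hwT
  have hexc : ({a | ∃ z ∈ L a, r z ∈ Metric.closedBall x η ∧ z ∉ (⋃₀ {T ∈ 𝓣 | ι x ∉ T})ᶜ} ∪
      ⋃ T ∈ C, {a | ∃ z ∈ L a, r z ∈ K T ∧ z ∉ U T}).Finite :=
    (hfin _ _ hU₀ Metric.isClosed_closedBall hballU₀).union
      (C.finite_toSet.biUnion fun T hT => hfin _ _ (hUo T hT) (hK T hT) (hKU T hT))
  have hballG : Metric.ball x η ⊆ G := fun w hw => hHG <| by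
    have := hOθ (hballO (Metric.ball_subset_closedBall hw))
    rw [Metric.mem_ball] at this
    rw [Metric.mem_closedBall]
    linarith
  obtain ⟨a, ⟨haH, haW⟩, ha⟩ := ((hrich (insert (Metric.ball x η) (W '' C))
    ((C.finite_toSet.image W).insert _) (insert_nonempty _ _)
    (forall_mem_insert.2 ⟨⟨Metric.isOpen_ball, Metric.nonempty_ball.2 hη, hballG⟩,
      forall_mem_image.2 fun T hT => ⟨hWo T hT, hWne T hT, (hWK T hT).trans (hKG T hT)⟩⟩)
    _ Metric.isClosed_closedBall hHG).sdiff hexc).nonempty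
  simp only [mem_union, mem_iUnion, mem_ofPred_eq, not_or, not_exists, not_and, not_not] at ha
  obtain ⟨ha₀, haT⟩ := ha
  have hQL : interior (B a) ⊆ L a := interior_subset.trans (hBL a)
  obtain ⟨z₀, hz₀, hz₀x⟩ := haW _ (mem_insert _ _)
  obtain ⟨T, hT, hz₀T⟩ := (h𝓣cov ▸ mem_univ z₀ : z₀ ∈ ⋃₀ 𝓣)
  have hTC : T ∈ C := by
    refine (hC T).2 ⟨hT, ?_⟩
    by_contra hxT
    exact ha₀ z₀ (hQL hz₀) (Metric.ball_subset_closedBall hz₀x) ⟨T, ⟨hT, hxT⟩, hz₀T⟩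
  obtain ⟨z₁, hz₁, hz₁W⟩ := haW _ (mem_insert_of_mem _ (mem_image_of_mem W hTC))
  obtain ⟨V, hV, hz₁V⟩ := (h𝓥cov ▸ mem_univ z₁ : z₁ ∈ ⋃₀ 𝓥)
  have hz₁K := hWK T hTC hz₁W
  have hyV : ι (y T) ∈ V := hUV T hTC z₁ (haT T hTC z₁ (hQL hz₁) hz₁K) V hV hz₁V
  obtain ⟨z, hzB, hzT, hzV⟩ := h𝓑binary _ (hB a) _ (h𝓣 hT) _ (h𝓥 hV)
    ⟨z₀, interior_subset hz₀, hz₀T⟩ ⟨z₁, interior_subset hz₁, hz₁V⟩ ⟨_, (hy T hTC).1, hyV⟩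
  have hzy : dist (r z) (y T) < η := by
    have := h𝓥dist V hV z hzV _ hyV
    rwa [hrι] at this
  obtain ⟨N, hN, hzN⟩ := haH z (hBL a hzB) (hnear T hTC z hzT)
  rcases hN with rfl | ⟨T', hT', rfl⟩
  · rw [Metric.mem_ball] at hzN
    linarith [hyx T hTC, dist_triangle_left x (y T) (r z)]
  · have hzK := hWK T' hT' hzN
    have hzy' : dist (r z) (y T') < η := hKy T' hT' hzK
    have hyy : y T = y T' := by
      by_contra hne
      linarith [hsep T hTC T' hT' hne, dist_triangle_left (y T) (y T') (r z)]
    exact hUT T' hT' z (haT T' hT' z (hBL a hzB) hzK) T hTC hyy hzT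

/-- The `n`-th digit in the binary expansion of a real number. -/
noncomputable def binaryDigit (n : ℕ) (a : ℝ) : Fin 2 :=
  if Odd ⌊2 ^ n * a⌋ then 1 else 0

lemma floor_eq_of_floor_two_mul_eq {s t : ℝ} (h : ⌊2 * s⌋ = ⌊2 * t⌋) : ⌊s⌋ = ⌊t⌋ := by
  have key : ∀ x : ℝ, ⌊x⌋ = ⌊2 * x⌋ / 2 := fun x => by
    have h₁ := Int.floor_le (2 * x)
    have h₂ := Int.lt_floor_add_one (2 * x)
    have h₃ : ((2 * (⌊2 * x⌋ / 2) : ℤ) : ℝ) ≤ ⌊2 * x⌋ := by exact_mod_cast (by omega)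
    have h₄ : ((⌊2 * x⌋ : ℤ) : ℝ) ≤ ((2 * (⌊2 * x⌋ / 2) + 1 : ℤ) : ℝ) := by
      exact_mod_cast (by omega)
    push_cast at h₃ h₄
    exact Int.floor_eq_iff.2 ⟨by linarith, by linarith⟩
  rw [key s, key t, h]

lemma binaryDigit_eq_of_floor_eq {N i : ℕ} {a b : ℝ} (h : ⌊2 ^ N * a⌋ = ⌊2 ^ N * b⌋)
    (hi : i ≤ N) : binaryDigit i a = binaryDigit i b := by
  induction N, hi using Nat.le_induction with
  | base => rw [binaryDigit, binaryDigit, h]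
  | succ N _ ih =>
    refine ih (floor_eq_of_floor_two_mul_eq ?_)
    rwa [pow_succ', mul_assoc, mul_assoc] at h

lemma exists_floor_imp_binaryDigit_eq (N : ℕ) (m : ℤ) (β : ℕ → Fin 2) (k : ℕ) :
    ∃ m' : ℤ, ∀ a : ℝ, ⌊2 ^ (N + k) * a⌋ = m' →
      ⌊2 ^ N * a⌋ = m ∧ ∀ i, N < i → i ≤ N + k → binaryDigit i a = β i := by
  induction k with
  | zero => exact ⟨m, fun a ha => ⟨ha, fun i h₁ h₂ => by omega⟩⟩
  | succ k ih =>
    obtain ⟨m', hm'⟩ := ih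
    refine ⟨2 * m' + (β (N + k + 1)).val, fun a ha => ?_⟩
    have hβ := (β (N + k + 1)).isLt
    have hprev : ⌊2 ^ (N + k) * a⌋ = m' := by
      obtain ⟨h₁, h₂⟩ := Int.floor_eq_iff.1 ha
      rw [← add_assoc, pow_succ', mul_assoc] at h₁ h₂
      push_cast at h₁ h₂
      have h₃ : (((β (N + k + 1)).val : ℕ) : ℝ) ≤ 1 := by exact_mod_cast (by omega)
      have h₄ : (0 : ℝ) ≤ (((β (N + k + 1)).val : ℕ) : ℝ) := by positivity
      exact Int.floor_eq_iff.2 ⟨by linarith, by linarith⟩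
    refine ⟨(hm' a hprev).1, fun i h₁ h₂ => ?_⟩
    rcases Nat.lt_or_ge (N + k) i with h | h
    · obtain rfl : i = N + k + 1 := by omega
      rw [binaryDigit, add_assoc, ha]
      generalize β (N + (k + 1)) = c
      fin_cases c <;> simp [parity_simps]
    · exact (hm' a hprev).2 i h₁ h

/-- Each nonempty open set of reals fixes only finitely many binary digits. -/
lemma exists_prescribe_binaryDigit {V : Set ℝ} (hV : IsOpen V) (hne : V.Nonempty) :
    ∃ (N : ℕ) (β₀ : ℕ → Fin 2), ∀ β : ℕ → Fin 2, (∀ i ≤ N, β i = β₀ i) → ∀ M : ℕ,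
      ∃ V' ⊆ V, IsOpen V' ∧ V'.Nonempty ∧ ∀ a ∈ V', ∀ i < M, binaryDigit i a = β i := by
  obtain ⟨a₀, ha₀⟩ := hne
  obtain ⟨ρ, hρ, hρV⟩ := Metric.isOpen_iff.1 hV a₀ ha₀
  obtain ⟨N, hN⟩ := exists_pow_lt_of_lt_one hρ (by norm_num : (1 / 2 : ℝ) < 1)
  refine ⟨N, fun i => binaryDigit i a₀, fun β hβ M => ?_⟩
  obtain ⟨m', hm'⟩ := exists_floor_imp_binaryDigit_eq N ⌊2 ^ N * a₀⌋ β M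
  have hpos : (0 : ℝ) < 2 ^ (N + M) := by positivity
  have hfloor : ∀ a ∈ Ioo ((m' : ℝ) / 2 ^ (N + M)) ((m' + 1) / 2 ^ (N + M)),
      ⌊2 ^ (N + M) * a⌋ = m' := by
    rintro a ⟨h₁, h₂⟩
    rw [div_lt_iff₀' hpos] at h₁
    rw [lt_div_iff₀' hpos] at h₂
    exact Int.floor_eq_iff.2 ⟨h₁.le, h₂⟩
  refine ⟨Ioo ((m' : ℝ) / 2 ^ (N + M)) ((m' + 1) / 2 ^ (N + M)), fun a ha => hρV ?_, isOpen_Ioo,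
    nonempty_Ioo.2 (div_lt_div_of_pos_right (lt_add_one _) hpos), fun a ha i hi => ?_⟩
  · have h := Int.abs_sub_lt_one_of_floor_eq_floor (hm' a (hfloor a ha)).1
    rw [← mul_sub, abs_mul, abs_of_pos (by positivity)] at h
    rw [Metric.mem_ball, Real.dist_eq]
    refine lt_trans ?_ hN
    rw [one_div, inv_pow]
    exact (lt_inv_mul_iff₀ (by positivity)).2 h |>.trans_eq (mul_one _)
  · obtain ⟨hN', hβ'⟩ := hm' a (hfloor a ha)
    rcases Nat.lt_or_ge N i with h | h
    · exact hβ' i h (by omega)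
    · exact (binaryDigit_eq_of_floor_eq hN' h).trans (hβ i h).symm

/-- The self-map of the Cantor space coded by a real number: the `k`-th entry of the image of `c`
is the binary digit whose index is a code of the first `k + 1` entries of `c`. -/
noncomputable def digitMap (a : ℝ) (c : ℕ → Fin 2) : ℕ → Fin 2 := fun k =>
  binaryDigit (Encodable.encode (PiNat.res c (k + 1))) a

lemma digitMap_apply_congr (a : ℝ) {c c' : ℕ → Fin 2} {k : ℕ} (h : ∀ i ≤ k, c i = c' i) :
    digitMap a c k = digitMap a c' k := by
  rw [digitMap, digitMap, PiNat.res_eq_res.2 fun i hi => h i (Nat.lt_succ_iff.1 hi)]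

lemma continuous_of_apply_congr {f : (ℕ → Fin 2) → ℕ → Fin 2}
    (hf : ∀ c c' k, (∀ i ≤ k, c i = c' i) → f c k = f c' k) : Continuous f := by
  refine continuous_pi fun k => continuous_def.2 fun s _ => isOpen_iff_mem_nhds.2 fun c hc => ?_
  refine Filter.mem_of_superset ((PiNat.isOpen_cylinder _ c (k + 1)).mem_nhds
    (PiNat.self_mem_cylinder c (k + 1))) fun c' hc' => ?_
  rw [mem_preimage, hf c' c k fun i hi => hc' i (Nat.lt_succ_iff.2 hi)]
  exact hc

/-- Reals in a given nonempty open set can be chosen to code, up to any finite depth, any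
non-anticipating self-map of the Cantor space with the right first few entries. -/
lemma exists_prescribe_digitMap {V : Set ℝ} (hV : IsOpen V) (hne : V.Nonempty) :
    ∃ (N : ℕ) (β₀ : ℕ → Fin 2), ∀ n ≥ N, ∀ f : (ℕ → Fin 2) → ℕ → Fin 2,
      (∀ c c' k, (∀ i ≤ k, c i = c' i) → f c k = f c' k) →
      (∀ c, ∀ k < n, f c k = β₀ (Encodable.encode (PiNat.res c (k + 1)))) → ∀ M : ℕ,
      ∃ V' ⊆ V, IsOpen V' ∧ V'.Nonempty ∧ ∀ a ∈ V', ∀ c, ∀ k < M, digitMap a c k = f c k := by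
  classical
  obtain ⟨N, β₀, h⟩ := exists_prescribe_binaryDigit hV hne
  refine ⟨N, β₀, fun n hn f hf hf₀ M => ?_⟩
  set β : ℕ → Fin 2 := fun i =>
    if h : ∃ p : (ℕ → Fin 2) × ℕ, n ≤ p.2 ∧ Encodable.encode (PiNat.res p.1 (p.2 + 1)) = i then
      f h.choose.1 h.choose.2 else β₀ i with hβdef
  have hβ : ∀ c k, β (Encodable.encode (PiNat.res c (k + 1))) = f c k := by
    intro c k
    rw [hβdef]
    dsimp only
    split_ifs with hex
    · obtain ⟨-, he⟩ := hex.choose_spec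
      generalize hex.choose = p at he
      have hres := Encodable.encode_injective he
      have hlen := congrArg List.length hres
      rw [PiNat.res_length, PiNat.res_length, add_left_inj] at hlen
      rw [hlen] at hres ⊢
      exact hf _ _ _ fun i hi => PiNat.res_eq_res.1 hres (Nat.lt_succ_iff.2 hi)
    · exact (hf₀ c k (by by_contra! hk; exact hex ⟨(c, k), hk, rfl⟩)).symm
  have hβ₀ : ∀ i ≤ N, β i = β₀ i := by
    intro i hi
    refine dif_neg ?_
    rintro ⟨⟨c, k⟩, hk, rfl⟩
    have := Encodable.length_le_encode (PiNat.res c (k + 1))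
    rw [PiNat.res_length] at this
    dsimp only at *
    omega
  obtain ⟨M', hM'⟩ := ((List.finite_length_le (Fin 2) M).image Encodable.encode).bddAbove
  obtain ⟨V', hV'V, hV', hV'ne, hdig⟩ := h β hβ₀ (M' + 1)
  refine ⟨V', hV'V, hV', hV'ne, fun a ha c k hk => ?_⟩
  rw [digitMap, hdig a ha _ (Nat.lt_succ_iff.2 (hM' ⟨_, ?_, rfl⟩)), hβ]
  rw [mem_ofPred_eq, PiNat.res_length]
  exact hk

/-- The continuous map of the Cantor space onto `[0, 1]` given by binary expansions. -/
noncomputable def ofBinary (c : ℕ → Fin 2) : unitInterval :=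
  ⟨Real.ofDigits c, Real.ofDigits_nonneg c, Real.ofDigits_le_one c⟩

lemma continuous_ofBinary : Continuous ofBinary :=
  Real.continuous_ofDigits.subtype_mk _

lemma dist_ofBinary_le {c c' : ℕ → Fin 2} {n : ℕ} (h : ∀ i < n, c i = c' i) :
    dist (ofBinary c) (ofBinary c') ≤ (1 / 2) ^ n := by
  have := Real.abs_ofDigits_sub_ofDigits_le h
  rwa [Nat.cast_ofNat, ← inv_pow, ← one_div] at this

lemma interior_image_ofBinary_cylinder_nonempty (w : ℕ → Fin 2) (n : ℕ) :
    (interior (ofBinary '' PiNat.cylinder w n)).Nonempty := by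
  set σ := ∑ i ∈ Finset.range n, Real.ofDigitsTerm w i with hσ
  have hval : ∀ c ∈ PiNat.cylinder w n,
      Real.ofDigits c = σ + (2 ^ n)⁻¹ * Real.ofDigits fun i => c (i + n) := by
    intro c hc
    rw [Real.ofDigits_eq_sum_add_ofDigits c n, hσ, Nat.cast_ofNat]
    congr 1
    exact Finset.sum_congr rfl fun i hi => by
      rw [Real.ofDigitsTerm, Real.ofDigitsTerm, hc i (Finset.mem_range.1 hi)]
  have hsub : ((↑) : unitInterval → ℝ) ⁻¹' Ioo σ (σ + (2 ^ n)⁻¹) ⊆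
      ofBinary '' PiNat.cylinder w n := by
    rintro x ⟨h₁, h₂⟩
    have hpos : (0 : ℝ) < 2 ^ n := by positivity
    obtain ⟨d, -, hd⟩ := Real.ofDigits_SurjOn (b := 2) one_lt_two
      (show (x - σ) * 2 ^ n ∈ Icc (0 : ℝ) 1 from
        ⟨mul_nonneg (by linarith) hpos.le, by
          rw [← le_div_iff₀ hpos, one_div]; linarith⟩)
    have hmem : (fun i => if i < n then w i else d (i - n)) ∈ PiNat.cylinder w n :=
      fun i hi => if_pos hi
    refine ⟨_, hmem, Subtype.ext ?_⟩
    change Real.ofDigits _ = _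
    rw [hval _ hmem]
    simp only [not_lt.2 (Nat.le_add_left n _), if_false, Nat.add_sub_cancel]
    rw [hd]
    field_simp
    ring
  have h₀ : 0 ≤ σ := Finset.sum_nonneg fun _ _ => Real.ofDigitsTerm_nonneg
  have h₁ : σ + (2 ^ n)⁻¹ ≤ 1 := by
    have hmem : (fun i => if i < n then w i else 1) ∈ PiNat.cylinder w n := fun i hi => if_pos hi
    have h := Real.ofDigits_le_one fun i => if i < n then w i else (1 : Fin 2)
    rw [hval _ hmem] at h
    simp only [not_lt.2 (Nat.le_add_left n _), if_false] at h
    rwa [show (fun _ : ℕ => (1 : Fin 2)) = fun _ => Fin.last 1 from rfl,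
      Real.ofDigits_const_last_eq_one, mul_one] at h
  have hpos : (0 : ℝ) < (2 ^ n)⁻¹ := by positivity
  refine ⟨⟨σ + (2 ^ n)⁻¹ / 2, by linarith, by linarith⟩,
    interior_maximal hsub (isOpen_Ioo.preimage continuous_subtype_val) ⟨?_, ?_⟩⟩
  · exact lt_add_of_pos_right _ (half_pos hpos)
  · exact add_lt_add_right (half_lt_self hpos) _

lemma exists_retraction_cantor {Ξ : Set (ℕ → Fin 2)} (hΞ : IsClosed Ξ) (hne : Ξ.Nonempty) :
    ∃ ρ : (ℕ → Fin 2) → ℕ → Fin 2, (∀ ξ ∈ Ξ, ρ ξ = ξ) ∧ (∀ c, ρ c ∈ Ξ) ∧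
      ∀ c c' k, (∀ i ≤ k, c i = c' i) → ρ c k = ρ c' k := by
  let _ : MetricSpace (ℕ → Fin 2) := PiNat.metricSpace
  obtain ⟨ρ, hρ, hrange, hlip⟩ := PiNat.exists_lipschitz_retraction_of_isClosed hΞ hne
  refine ⟨ρ, hρ, fun c => hrange ▸ mem_range_self c, fun c c' k h => ?_⟩
  have hdist : dist c c' ≤ (1 / 2 : ℝ) ^ (k + 1) :=
    PiNat.mem_cylinder_iff_dist_le.1 fun i hi => h i (Nat.lt_succ_iff.1 hi)
  have hdist' : dist (ρ c) (ρ c') ≤ (1 / 2 : ℝ) ^ (k + 1) :=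
    (by simpa using hlip.dist_le_mul c c' : dist (ρ c) (ρ c') ≤ dist c c').trans hdist
  exact PiNat.mem_cylinder_iff_dist_le.2 hdist' k (Nat.lt_succ_self k)

lemma eventually_ofBinary_mem {U : Set unitInterval} (hU : IsOpen U) {ζ : ℕ → Fin 2}
    (hζ : ofBinary ζ ∈ U) :
    ∀ᶠ M : ℕ in Filter.atTop, ∀ ξ : ℕ → Fin 2, (∀ i < M, ξ i = ζ i) → ofBinary ξ ∈ U := by
  obtain ⟨ε, hε, hεU⟩ := Metric.isOpen_iff.1 hU _ hζ
  filter_upwards [(tendsto_pow_atTop_nhds_zero_of_lt_one (by norm_num : (0 : ℝ) ≤ 1 / 2)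
    (by norm_num)).eventually_lt_const hε] with M hM ξ hξ
  exact hεU ((dist_ofBinary_le hξ).trans_lt hM)

lemma finite_setOf_eventually_zero (n : ℕ) : {ξ : ℕ → Fin 2 | ∀ k, n ≤ k → ξ k = 0}.Finite := by
  refine (finite_range fun (g : Fin n → Fin 2) (k : ℕ) =>
    if h : k < n then g ⟨k, h⟩ else 0).subset fun ξ hξ => ⟨fun i => ξ i, funext fun k => ?_⟩
  by_cases h : k < n
  · simp [h]
  · simp [h, hξ k (not_lt.1 h)]

lemma infinite_inter_of_subset_closure {A V : Set ℝ} (hV : IsOpen V) (hne : V.Nonempty)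
    (h : V ⊆ closure A) : (A ∩ V).Infinite := by
  intro hfin
  obtain ⟨x, hx⟩ := hne
  refine infinite_of_mem_nhds x (hV.mem_nhds hx) (hfin.subset ?_)
  rw [← hfin.isClosed.closure_eq, inter_comm]
  exact (subset_inter subset_rfl h).trans hV.inter_closure

/-- Over a somewhere dense set of reals, the maps `digitMap` are rich: they push given cylinders
into any finite family of small open sets while avoiding the rest of a given closed set. -/
lemma exists_isOpen_forall_infinite_digitMap {A : Set ℝ} (hA : (interior (closure A)).Nonempty)
    (b : ℕ → Fin 2) (n₀ : ℕ) :
    ∃ G : Set unitInterval, IsOpen G ∧ G.Nonempty ∧ ∀ 𝒲 : Set (Set unitInterval), 𝒲.Finite →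
      𝒲.Nonempty → (∀ W ∈ 𝒲, IsOpen W ∧ W.Nonempty ∧ W ⊆ G) → ∀ H, IsClosed H → H ⊆ G →
        {a ∈ A | (∀ c, ofBinary (digitMap a c) ∈ H → ofBinary (digitMap a c) ∈ ⋃₀ 𝒲) ∧
          ∀ W ∈ 𝒲, ∃ c ∈ PiNat.cylinder b n₀, ofBinary (digitMap a c) ∈ W}.Infinite := by
  classical
  obtain ⟨N, β₀, hpresc⟩ := exists_prescribe_digitMap isOpen_interior hA
  set n := max N n₀
  set w : ℕ → Fin 2 := fun k => β₀ (Encodable.encode (PiNat.res b (k + 1)))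
  set Z : Set (ℕ → Fin 2) := {ξ | ∀ k, n ≤ k → ξ k = 0}
  have hZ : Z.Finite := finite_setOf_eventually_zero n
  refine ⟨interior (ofBinary '' PiNat.cylinder w n) \ ofBinary '' Z,
    isOpen_interior.sdiff (hZ.image _).isClosed, ?_, fun 𝒲 h𝒲fin h𝒲ne h𝒲 H hH hHG => ?_⟩
  · obtain ⟨x, hx⟩ := interior_image_ofBinary_cylinder_nonempty w n
    exact ((infinite_of_mem_nhds x (isOpen_interior.mem_nhds hx)).sdiff (hZ.image _)).nonempty
  have hξ : ∀ W ∈ 𝒲, ∃ ξ ∈ PiNat.cylinder w n, ofBinary ξ ∈ W := by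
    intro W hW
    obtain ⟨-, ⟨x, hx⟩, hWG⟩ := h𝒲 W hW
    obtain ⟨ξ, hξ, rfl⟩ := interior_subset (hWG hx).1
    exact ⟨ξ, hξ, hx⟩
  choose! ξ hξw hξW using hξ
  obtain ⟨ρ, hρid, hρmem, hρ⟩ :=
    exists_retraction_cantor (h𝒲fin.image ξ).isClosed (h𝒲ne.image ξ)
  have hρw : ∀ c, ∀ k < n, ρ c k = w k := by
    intro c k hk
    obtain ⟨W, hW, hWc⟩ := hρmem c
    rw [← hWc]
    exact hξw W hW k hk
  set f : (ℕ → Fin 2) → ℕ → Fin 2 := fun c =>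
    if c ∈ PiNat.cylinder b n then ρ fun k => if k < n then w k else c k
    else fun k => if k < n then β₀ (Encodable.encode (PiNat.res c (k + 1))) else 0
  have hf₁ : ∀ c ∈ PiNat.cylinder b n, f c = ρ fun k => if k < n then w k else c k :=
    fun c hc => if_pos hc
  have hf₂ : ∀ c ∉ PiNat.cylinder b n,
      f c = fun k => if k < n then β₀ (Encodable.encode (PiNat.res c (k + 1))) else 0 :=
    fun c hc => if_neg hc
  have hf₀ : ∀ c, ∀ k < n, f c k = β₀ (Encodable.encode (PiNat.res c (k + 1))) := by
    intro c k hk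
    by_cases hc : c ∈ PiNat.cylinder b n
    · rw [hf₁ c hc, hρw _ k hk,
        PiNat.res_eq_res.2 fun i hi => hc i (hi.trans_le hk)]
    · rw [hf₂ c hc]
      exact if_pos hk
  have hf : ∀ c c' k, (∀ i ≤ k, c i = c' i) → f c k = f c' k := by
    intro c c' k h
    rcases lt_or_ge k n with hk | hk
    · rw [hf₀ c k hk, hf₀ c' k hk, PiNat.res_eq_res.2 fun i hi => h i (Nat.lt_succ_iff.1 hi)]
    have hiff : c ∈ PiNat.cylinder b n ↔ c' ∈ PiNat.cylinder b n :=
      forall₂_congr fun i hi => by rw [h i (hi.le.trans hk)]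
    by_cases hc : c ∈ PiNat.cylinder b n
    · rw [hf₁ c hc, hf₁ c' (hiff.1 hc)]
      exact hρ _ _ k fun i hi => by simp only [h i hi]
    · rw [hf₂ c hc, hf₂ c' (mt hiff.2 hc)]
      simp only [not_lt.2 hk, if_false]
  have hM₁ : ∀ᶠ M : ℕ in Filter.atTop, ∀ W ∈ 𝒲, ∀ η : ℕ → Fin 2, (∀ i < M, η i = ξ W i) →
      ofBinary η ∈ W :=
    (Filter.eventually_all_finite h𝒲fin).2 fun W hW =>
      eventually_ofBinary_mem (h𝒲 W hW).1 (hξW W hW)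
  have hM₂ : ∀ᶠ M : ℕ in Filter.atTop, ∀ ζ ∈ Z, ∀ η : ℕ → Fin 2, (∀ i < M, η i = ζ i) →
      ofBinary η ∈ Hᶜ :=
    (Filter.eventually_all_finite hZ).2 fun ζ hζ =>
      eventually_ofBinary_mem hH.isOpen_compl fun h => (hHG h).2 ⟨ζ, hζ, rfl⟩
  obtain ⟨M, hM₁, hM₂⟩ := (hM₁.and hM₂).exists
  obtain ⟨V, hVA, hV, hVne, hVf⟩ := hpresc n (le_max_left _ _) f hf hf₀ M
  refine (infinite_inter_of_subset_closure hV hVne (hVA.trans interior_subset)).mono ?_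
  rintro a ⟨haA, haV⟩
  refine ⟨haA, fun c hc => ?_, fun W hW => ?_⟩
  · by_cases hcb : c ∈ PiNat.cylinder b n
    · obtain ⟨W, hW, hWc⟩ := hρmem fun k => if k < n then w k else c k
      refine ⟨W, hW, hM₁ W hW _ fun i hi => ?_⟩
      rw [hVf a haV c i hi, hf₁ c hcb, hWc]
    · refine absurd hc (hM₂ (f c) (fun k hk => ?_) _ (hVf a haV c))
      rw [hf₂ c hcb]
      exact if_neg (not_lt.2 hk)
  · have hcb : (fun k => if k < n then b k else ξ W k) ∈ PiNat.cylinder b n :=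
      fun i hi => if_pos hi
    refine ⟨_, PiNat.cylinder_anti b (le_max_right _ _) hcb, hM₁ W hW _ fun i hi => ?_⟩
    rw [hVf a haV _ i hi, hf₁ _ hcb]
    have : (fun k => if k < n then w k else if k < n then b k else ξ W k) = ξ W := by
      funext k
      split_ifs with hk
      · exact (hξw W hW k hk).symm
      · rfl
    rw [this, hρid _ (mem_image_of_mem ξ hW)]

/-- The closed subspace of `[0, 1] × αD` made of the limit interval `[0, 1] × {∞}` and, for each
`a ∈ A`, of a copy of the range of `ofBinary ∘ digitMap a` at level `j a`. -/
def digitFan {D : Type u} (A : Set ℝ) (j : A → D) : Set (unitInterval × OnePoint D) :=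
  {p | p.2 = OnePoint.infty ∨
    ∃ a : A, p.2 = (j a : OnePoint D) ∧ ∃ c, p.1 = ofBinary (digitMap a c)}

/-- The part of `digitFan A j` at level `j a`. -/
def digitFanLevel {D : Type u} (A : Set ℝ) (j : A → D) (a : A) : Set (digitFan A j) :=
  {z | z.1.2 = (j a : OnePoint D)}

/-- The parametrization of the level `j a` of `digitFan A j` by the Cantor space. -/
noncomputable def digitFanPoint {D : Type u} (A : Set ℝ) (j : A → D) (a : A)
    (c : ℕ → Fin 2) : digitFan A j :=
  ⟨(ofBinary (digitMap a c), (j a : OnePoint D)), Or.inr ⟨a, rfl, c, rfl⟩⟩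

lemma isClopen_singleton_coe {D : Type u} [TopologicalSpace D] [DiscreteTopology D]
    (d : D) : IsClopen {(d : OnePoint D)} := by
  refine ⟨isClosed_singleton, ?_⟩
  rw [← image_singleton]
  exact OnePoint.isOpen_image_coe.2 (isOpen_discrete _)

lemma finite_coe_notMem {D : Type u} [TopologicalSpace D] [DiscreteTopology D]
    {v : Set (OnePoint D)} (hv : IsOpen v) (h : OnePoint.infty ∈ v) :
    {d : D | (d : OnePoint D) ∉ v}.Finite :=
  ((OnePoint.isOpen_iff_of_mem h).1 hv).2.finite_of_discrete

lemma continuous_ofBinary_digitMap (a : ℝ) : Continuous fun c => ofBinary (digitMap a c) :=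
  continuous_ofBinary.comp
    (continuous_of_apply_congr fun _ _ _ h => digitMap_apply_congr a h)

lemma isClosed_digitFan {D : Type u} [TopologicalSpace D] [DiscreteTopology D] {A : Set ℝ}
    {j : A → D} (hj : Function.Injective j) : IsClosed (digitFan A j) := by
  have h : digitFan A j = ⋂ d : D, {p | p.2 = (d : OnePoint D)}ᶜ ∪
      Prod.fst ⁻¹' ⋃ a ∈ j ⁻¹' {d}, range fun c => ofBinary (digitMap a c) := by
    ext ⟨x, q⟩
    induction q using OnePoint.rec with
    | infty => simp [digitFan]
    | coe d =>
      simp only [digitFan, mem_ofPred_eq, OnePoint.coe_ne_infty, false_or, OnePoint.coe_eq_coe,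
        mem_iInter, mem_union, mem_compl_iff, mem_preimage, mem_iUnion, mem_singleton_iff,
        mem_range, exists_prop, @eq_comm _ x]
      exact ⟨fun ⟨a, ha, hx⟩ e => or_iff_not_imp_left.2 fun he =>
        ⟨a, ha.symm.trans (not_not.1 he), hx⟩, fun h =>
        let ⟨a, ha, hx⟩ := (h d).resolve_left fun h => h rfl
        ⟨a, ha.symm, hx⟩⟩
  rw [h]
  refine isClosed_iInter fun d => IsClosed.union ?_ (IsClosed.preimage continuous_fst ?_)
  · exact ((isClopen_singleton_coe d).isOpen.preimage continuous_snd).isClosed_compl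
  · exact ((finite_singleton d).preimage hj.injOn).isClosed_biUnion fun a _ =>
      (isCompact_range (continuous_ofBinary_digitMap a)).isClosed

lemma isClopen_digitFanLevel {D : Type u} [TopologicalSpace D] [DiscreteTopology D] {A : Set ℝ}
    {j : A → D} (a : A) : IsClopen (digitFanLevel A j a) :=
  (isClopen_singleton_coe (j a)).preimage (continuous_snd.comp continuous_subtype_val)

lemma digitFanPoint_mem_level {D : Type u} {A : Set ℝ} {j : A → D} (a : A) (c : ℕ → Fin 2) :
    digitFanPoint A j a c ∈ digitFanLevel A j a := rfl

lemma continuous_digitFanPoint {D : Type u} [TopologicalSpace D] {A : Set ℝ}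
    {j : A → D} (a : A) : Continuous (digitFanPoint A j a) :=
  ((continuous_ofBinary_digitMap a).prodMk continuous_const).subtype_mk _

lemma exists_eq_digitFanPoint {D : Type u} {A : Set ℝ} {j : A → D} (hj : Function.Injective j)
    {a : A} {z : digitFan A j} (hz : z ∈ digitFanLevel A j a) :
    ∃ c, z = digitFanPoint A j a c := by
  obtain ⟨⟨x, q⟩, h⟩ := z
  obtain rfl : q = (j a : OnePoint D) := hz
  rcases h with h | ⟨a', ha', c, hc⟩
  · exact absurd h (OnePoint.coe_ne_infty _)
  · obtain rfl := hj (OnePoint.coe_injective ha')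
    exact ⟨c, Subtype.ext (Prod.ext hc rfl)⟩

/-- If cylinders are attached to the points of a nonmeager set of reals, then some cylinder is
attached to the points of a somewhere dense set. -/
lemma exists_res_interior_closure_nonempty {A : Set ℝ} (hA : ¬ IsMeagre A)
    (b : A → ℕ → Fin 2) (n : A → ℕ) :
    ∃ a₀ : A, (interior (closure
      (Subtype.val '' {a : A | PiNat.res (b a) (n a) = PiNat.res (b a₀) (n a₀)}))).Nonempty := by
  by_contra! h
  refine hA ?_
  have hcov : A ⊆ ⋃ l : List (Fin 2), Subtype.val '' {a : A | PiNat.res (b a) (n a) = l} :=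
    fun x hx => mem_iUnion.2 ⟨_, ⟨x, hx⟩, rfl, rfl⟩
  refine (isMeagre_iUnion fun l => IsNowhereDense.isMeagre ?_).mono hcov
  rcases eq_empty_or_nonempty {a : A | PiNat.res (b a) (n a) = l} with hl | ⟨a₀, rfl⟩
  · rw [hl, image_empty]
    exact isNowhereDense_empty
  · exact h a₀

/-- The fan over a nonmeager set of reals is not supercompact. -/
lemma not_isSupercompact_digitFan {D : Type u} [TopologicalSpace D] [DiscreteTopology D]
    {A : Set ℝ} {j : A → D} (hA : ¬ IsMeagre A) (hj : Function.Injective j) :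
    ¬ IsSupercompact (digitFan A j) := by
  have : CompactSpace (digitFan A j) :=
    isCompact_iff_compactSpace.1 (isClosed_digitFan hj).isCompact
  refine not_isSupercompact_of_rich_levels (α := A) (r := fun z : digitFan A j => z.1.1)
    (ι := fun x => ⟨(x, OnePoint.infty), Or.inl rfl⟩) (L := digitFanLevel A j)
    (continuous_fst.comp continuous_subtype_val)
    ((continuous_id.prodMk continuous_const).subtype_mk _) (fun _ => rfl)
    isClopen_digitFanLevel (fun a => ⟨_, digitFanPoint_mem_level a 0⟩) ?_ ?_
  · intro U K hU hK hKU
    obtain ⟨O, hO, rfl⟩ := isOpen_induced_iff.1 hU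
    obtain ⟨u, v, -, hv, hKu, hiv, huv⟩ := generalized_tube_lemma hK.isCompact
      (isCompact_singleton (x := (OnePoint.infty : OnePoint D))) hO (by
        rintro ⟨x, q⟩ ⟨hx, rfl⟩
        exact hKU ⟨x, hx, rfl⟩)
    refine ((finite_coe_notMem hv (hiv rfl)).preimage hj.injOn).subset ?_
    rintro a ⟨z, hza, hzK, hzO⟩ hav
    exact hzO (huv ⟨hKu hzK, (hza ▸ hav : z.1.2 ∈ v)⟩)
  · intro Q hQ hQne hQL
    have hcyl : ∀ a, ∃ (b : ℕ → Fin 2) (n : ℕ),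
        ∀ c ∈ PiNat.cylinder b n, digitFanPoint A j a c ∈ Q a := by
      intro a
      obtain ⟨z, hz⟩ := hQne a
      obtain ⟨c, rfl⟩ := exists_eq_digitFanPoint hj (hQL a hz)
      obtain ⟨_, ⟨b, n, rfl⟩, -, hbn⟩ :=
        (PiNat.isTopologicalBasis_cylinders fun _ : ℕ => Fin 2).exists_subset_of_mem_open
          (show c ∈ digitFanPoint A j a ⁻¹' Q a from hz)
          ((hQ a).preimage (continuous_digitFanPoint a))
      exact ⟨b, n, hbn⟩
    choose b n hbn using hcyl
    obtain ⟨a₀, ha₀⟩ := exists_res_interior_closure_nonempty hA b n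
    obtain ⟨G, hG, hGne, hrich⟩ := exists_isOpen_forall_infinite_digitMap ha₀ (b a₀) (n a₀)
    refine ⟨G, hG, hGne, fun 𝒲 h𝒲fin h𝒲ne h𝒲 H hH hHG =>
      ((hrich 𝒲 h𝒲fin h𝒲ne h𝒲 H hH hHG).mono ?_).of_image Subtype.val⟩
    rintro _ ⟨⟨a, ha, rfl⟩, haH, haW⟩
    refine ⟨a, ⟨fun z hz hzH => ?_, fun W hW => ?_⟩, rfl⟩
    · obtain ⟨c, rfl⟩ := exists_eq_digitFanPoint hj hz
      exact haH c hzH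
    · obtain ⟨c, hc, hcW⟩ := haW W hW
      refine ⟨_, hbn a c ?_, hcW⟩
      have hn : n a = n a₀ := by simpa only [PiNat.res_length] using congrArg List.length ha
      rw [PiNat.cylinder_eq_res] at hc ⊢
      exact (hn ▸ hc : PiNat.res c (n a) = _).trans ha.symm

/-- The weight of `digitFan A j` is the cardinality of `A`. -/
lemma topWeight_digitFan {D : Type u} [TopologicalSpace D] [DiscreteTopology D] {A : Set ℝ}
    {j : A → D} (hA : Infinite A) (hj : Function.Injective j) :
    topWeight (digitFan A j) = Cardinal.lift.{u} (Cardinal.mk A) := by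
  refine le_antisymm ?_ ?_
  · set N : countableBasis unitInterval × Finset A × Bool → Set (digitFan A j) := fun i =>
      {z | z.1.1 ∈ i.1.1 ∧ (i.2.2 = true ↔ ∃ a ∈ i.2.1, z ∈ digitFanLevel A j a)}
    have hclopen : ∀ E : Finset A, IsClopen {z | ∃ a ∈ E, z ∈ digitFanLevel A j a} := by
      intro E
      convert E.finite_toSet.isClopen_biUnion fun a _ => isClopen_digitFanLevel (j := j) a using 1
      ext z
      simp
    have hN : IsTopologicalBasis (range N) := by
      refine isTopologicalBasis_of_isOpen_of_nhds ?_ fun z _ hz hzO => ?_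
      · rintro _ ⟨⟨U, E, s⟩, rfl⟩
        have hU : IsOpen {z : digitFan A j | z.1.1 ∈ U.1} :=
          (isOpen_of_mem_countableBasis U.2).preimage (continuous_fst.comp continuous_subtype_val)
        cases s
        · convert! hU.inter (hclopen E).compl.isOpen using 1
          ext z
          simp [N]
        · convert! hU.inter (hclopen E).isOpen using 1
          ext z
          simp [N]
      · obtain ⟨O, hO, rfl⟩ := isOpen_induced_iff.1 hzO
        obtain ⟨u, v, hu, hv, hzu, hzv, huv⟩ := isOpen_prod_iff.1 hO z.1.1 z.1.2 hz
        obtain ⟨U, hU, hzU, hUu⟩ :=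
          (isBasis_countableBasis unitInterval).exists_subset_of_mem_open hzu hu
        by_cases hlev : ∃ a, z ∈ digitFanLevel A j a
        · obtain ⟨a, ha⟩ := hlev
          refine ⟨_, ⟨(⟨U, hU⟩, {a}, true), rfl⟩, ⟨hzU, by simpa using ha⟩, ?_⟩
          rintro w ⟨hwU, hw⟩
          obtain ⟨a', ha', hwa⟩ := hw.1 rfl
          obtain rfl := Finset.mem_singleton.1 ha'
          exact huv ⟨hUu hwU, (show w.1.2 = z.1.2 from hwa.trans ha.symm) ▸ hzv⟩
        · have hz : z.1.2 = OnePoint.infty :=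
            z.2.resolve_right fun ⟨a, ha, _⟩ => hlev ⟨a, ha⟩
          have hfin := (finite_coe_notMem hv (hz ▸ hzv)).preimage hj.injOn
          refine ⟨_, ⟨(⟨U, hU⟩, hfin.toFinset, false), rfl⟩, ⟨hzU, ?_⟩, ?_⟩
          · exact iff_of_false Bool.false_ne_true fun ⟨a, _, ha⟩ => hlev ⟨a, ha⟩
          · rintro w ⟨hwU, hw⟩
            refine huv ⟨hUu hwU, ?_⟩
            by_contra hwv
            rcases w.2 with hw' | ⟨a, ha, -⟩
            · exact hwv (hw'.trans hz.symm ▸ hzv)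
            · have hav : (j a : OnePoint D) ∉ v := ha ▸ hwv
              exact absurd (hw.2 ⟨a, hfin.mem_toFinset.2 hav, ha⟩) Bool.false_ne_true
    have hle : topWeight (digitFan A j) ≤ Cardinal.mk (range N) := csInf_le' ⟨_, hN, rfl⟩
    refine hle.trans ?_
    have hrange := Cardinal.mk_range_le_lift (f := N)
    rw [Cardinal.lift_id'] at hrange
    refine hrange.trans (Cardinal.lift_le.2 ?_)
    have hA' := Cardinal.aleph0_le_mk A
    rw [Cardinal.mk_prod, Cardinal.mk_prod, Cardinal.mk_finset_of_infinite]
    simp only [Cardinal.lift_id]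
    refine Cardinal.mul_le_of_le hA' ?_ (Cardinal.mul_le_of_le hA' le_rfl ?_)
    · exact (Cardinal.mk_le_aleph0_iff.2 (countable_countableBasis _).to_subtype).trans hA'
    · exact (Cardinal.mk_le_aleph0).trans hA'
  · refine le_csInf ⟨_, _, isTopologicalBasis_opens, rfl⟩ ?_
    rintro _ ⟨𝓤, h𝓤, rfl⟩
    have hex : ∀ a : A, ∃ U : 𝓤, digitFanPoint A j a 0 ∈ U.1 ∧ U.1 ⊆ digitFanLevel A j a := by
      intro a
      obtain ⟨U, hU, hmem, hsub⟩ := h𝓤.exists_subset_of_mem_open (digitFanPoint_mem_level a 0)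
        (isClopen_digitFanLevel (j := j) a).isOpen
      exact ⟨⟨U, hU⟩, hmem, hsub⟩
    choose U hmem hsub using hex
    have hinj : Function.Injective U := fun a a' h =>
      hj (OnePoint.coe_injective (hsub a' (h ▸ hmem a)))
    simpa using Cardinal.lift_mk_le_lift_mk_of_injective hinj

lemma infinite_of_not_isMeagre {A : Set ℝ} (hA : ¬ IsMeagre A) : Infinite A := by
  refine infinite_coe_iff.2 fun hfin => hA (IsNowhereDense.isMeagre ?_)
  rw [IsNowhereDense, hfin.isClosed.closure_eq]
  exact interior_eq_empty_iff_dense_compl.2 (hfin.countable.dense_compl ℝ)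

lemma exists_not_isMeagre_mk_eq : ∃ A : Set ℝ, ¬ IsMeagre A ∧ Cardinal.mk A = nonMeagerCard :=
  csInf_mem (s := {c | ∃ A : Set ℝ, ¬ IsMeagre A ∧ Cardinal.mk A = c})
    ⟨_, univ, not_isMeagre_of_isOpen isOpen_univ univ_nonempty, rfl⟩

/-- The product `𝕀 × αD` of the unit interval and the one-point compactification of a
discrete space `D` of cardinality at least `non(M)` contains a closed subspace of weight
`non(M)` which is not supercompact; in particular `𝕀 × αD` is not hereditarily
supercompact. -/
theorem interval_times_onePoint_not_hereditarily_supercompact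
    (D : Type u) [TopologicalSpace D] [DiscreteTopology D]
    (hD : Cardinal.lift.{u} nonMeagerCard ≤ Cardinal.mk D) :
    (∃ X : Set (unitInterval × OnePoint D), IsClosed X ∧
        topWeight X = Cardinal.lift.{u} nonMeagerCard ∧ ¬ IsSupercompact X) ∧
      ¬ IsHereditarilySupercompact (unitInterval × OnePoint D) := by
  obtain ⟨A, hA, hcard⟩ := exists_not_isMeagre_mk_eq
  rw [← hcard, ← Cardinal.lift_uzero (Cardinal.mk D), Cardinal.lift_mk_le'] at hD
  obtain ⟨j, hj⟩ := hD
  have hnot := not_isSupercompact_digitFan hA hj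
  exact ⟨⟨digitFan A j, isClosed_digitFan hj,
    hcard ▸ topWeight_digitFan (infinite_of_not_isMeagre hA) hj, hnot⟩,
    fun h => hnot (h _ (isClosed_digitFan hj))⟩
end

section
/- Let 𝕀 = [0,1], let D be a discrete space, and let X ⊆ 𝕀 × αD be a closed subset. If the space X is supercompact, then the set of sections {X_i : i ∈ D} is a meager subset of the hyperspace exp(𝕀). -/
open Set Topology TopologicalSpace

universe u

/-- Intersections of complements of members of the subbase `S`. -/
def IsSubbaseConvex {Z : Type*} (S : Set (Set Z)) (H : Set Z) : Prop :=
  ∃ L ⊆ S, H = (⋃₀ L)ᶜ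

namespace IsSubbaseConvex

variable {Z : Type*} {S : Set (Set Z)} {H H₁ H₂ H₃ : Set Z}

theorem univ (S : Set (Set Z)) : IsSubbaseConvex S Set.univ := ⟨∅, empty_subset _, by simp⟩

theorem compl_mem {s : Set Z} (hs : s ∈ S) : IsSubbaseConvex S sᶜ :=
  ⟨{s}, by simpa using hs, by simp⟩

theorem inter (h₁ : IsSubbaseConvex S H₁) (h₂ : IsSubbaseConvex S H₂) :
    IsSubbaseConvex S (H₁ ∩ H₂) := by
  obtain ⟨L₁, hL₁, rfl⟩ := h₁
  obtain ⟨L₂, hL₂, rfl⟩ := h₂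
  exact ⟨L₁ ∪ L₂, union_subset hL₁ hL₂, by rw [sUnion_union, compl_union]⟩

theorem isClosed [t : TopologicalSpace Z] (hS : generateFrom S = t) (h : IsSubbaseConvex S H) :
    IsClosed H := by
  obtain ⟨L, hL, rfl⟩ := h
  have hopen : ∀ s ∈ L, IsOpen s := fun s hs => hS ▸ isOpen_generateFrom_of_mem (hL hs)
  exact (isOpen_sUnion hopen).isClosed_compl

/-- Three pairwise intersecting convex sets of a binary subbase have a common point. -/
theorem nonempty_inter_inter
    (hS : ∀ C ⊆ S, ⋃₀ C = Set.univ → ∃ T ⊆ C, T.Finite ∧ T.ncard ≤ 2 ∧ ⋃₀ T = Set.univ)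
    (h₁ : IsSubbaseConvex S H₁) (h₂ : IsSubbaseConvex S H₂) (h₃ : IsSubbaseConvex S H₃)
    (h₁₂ : (H₁ ∩ H₂).Nonempty) (h₁₃ : (H₁ ∩ H₃).Nonempty) (h₂₃ : (H₂ ∩ H₃).Nonempty) :
    (H₁ ∩ H₂ ∩ H₃).Nonempty := by
  obtain ⟨L₁, hL₁, rfl⟩ := h₁
  obtain ⟨L₂, hL₂, rfl⟩ := h₂
  obtain ⟨L₃, hL₃, rfl⟩ := h₃
  by_contra hne
  rw [not_nonempty_iff_eq_empty, ← compl_union, ← compl_union, ← sUnion_union, ← sUnion_union,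
    compl_empty_iff] at hne
  obtain ⟨T, hT, hfin, hcard, hcov⟩ := hS _ (union_subset (union_subset hL₁ hL₂) hL₃) hne
  have key : ∀ s ∈ T, ∀ t ∈ T, ∃ x, x ∉ s ∧ x ∉ t := by
    obtain ⟨a, ha₁, ha₂⟩ := h₁₂
    obtain ⟨b, hb₁, hb₂⟩ := h₁₃
    obtain ⟨c, hc₁, hc₂⟩ := h₂₃
    simp only [mem_compl_iff, mem_sUnion, not_exists, not_and] at ha₁ ha₂ hb₁ hb₂ hc₁ hc₂
    intro s hs t ht
    rcases hT hs with (hs | hs) | hs <;> rcases hT ht with (ht | ht) | ht <;>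
    first
      | exact ⟨a, by solve_by_elim, by solve_by_elim⟩
      | exact ⟨b, by solve_by_elim, by solve_by_elim⟩
      | exact ⟨c, by solve_by_elim, by solve_by_elim⟩
  obtain ⟨s, t, hst⟩ : ∃ s t, T ⊆ {s, t} := by
    rcases Nat.lt_or_ge T.ncard 2 with h | h
    · obtain ⟨a, ha⟩ :=
        (Set.ncard_le_one_iff_subset_singleton (hs := hfin)).1 (by omega : T.ncard ≤ 1)
      exact ⟨a, a, by simpa using ha⟩
    · obtain ⟨a, b, -, hab⟩ := Set.ncard_eq_two.1 (le_antisymm hcard h)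
      exact ⟨a, b, hab.subset⟩
  obtain ⟨x₀, -⟩ := h₁₂
  have mem : ∀ x, ∃ u ∈ T, x ∈ u := fun x => by
    have : x ∈ ⋃₀ T := hcov ▸ mem_univ x
    simpa using this
  by_cases hs : s ∈ T <;> by_cases ht : t ∈ T
  · obtain ⟨x, hxs, hxt⟩ := key s hs t ht
    obtain ⟨u, hu, hxu⟩ := mem x
    rcases hst hu with rfl | rfl <;> contradiction
  · obtain ⟨x, hxs, -⟩ := key s hs s hs
    obtain ⟨u, hu, hxu⟩ := mem x
    rcases hst hu with rfl | rfl <;> contradiction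
  · obtain ⟨x, hxt, -⟩ := key t ht t ht
    obtain ⟨u, hu, hxu⟩ := mem x
    rcases hst hu with rfl | rfl <;> contradiction
  · obtain ⟨u, hu, hxu⟩ := mem x₀
    rcases hst hu with rfl | rfl <;> contradiction

/-- In a compact Hausdorff space every point of an open set has a neighbourhood inside it which is
a finite union of convex sets, all of them containing the point. -/
theorem exists_finite_nhds [t : TopologicalSpace Z] [CompactSpace Z] [T2Space Z]
    (hS : generateFrom S = t) {z : Z} {O : Set Z} (hO : IsOpen O) (hz : z ∈ O) :
    ∃ F : Set (Set Z), F.Finite ∧ (∀ H ∈ F, IsSubbaseConvex S H ∧ z ∈ H ∧ H ⊆ O) ∧ ⋃₀ F ∈ 𝓝 z := by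
  obtain ⟨O', hO', hzO', hO'O⟩ : ∃ O', IsOpen O' ∧ z ∈ O' ∧ closure O' ⊆ O := by
    obtain ⟨V, hV, hVc, hVO⟩ := exists_mem_nhds_isClosed_subset (hO.mem_nhds hz)
    refine ⟨interior V, isOpen_interior, mem_interior_iff_mem_nhds.2 hV, ?_⟩
    exact (closure_minimal interior_subset hVc).trans hVO
  have main : ∃ F : Set (Set Z), F.Finite ∧ (∀ H ∈ F, IsSubbaseConvex S H) ∧ O' ⊆ ⋃₀ F ∧
      Disjoint (⋃₀ F) Oᶜ := by
    refine hO.isClosed_compl.isCompact.induction_on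
      (p := fun s => ∃ F : Set (Set Z), F.Finite ∧ (∀ H ∈ F, IsSubbaseConvex S H) ∧ O' ⊆ ⋃₀ F ∧
        Disjoint (⋃₀ F) s) ?_ ?_ ?_ ?_
    · exact ⟨{Set.univ}, finite_singleton _, by simp [univ], by simp, by simp⟩
    · rintro s t hst ⟨F, h1, h2, h3, h4⟩
      exact ⟨F, h1, h2, h3, h4.mono_right hst⟩
    · rintro s t ⟨F, h1, h2, h3, h4⟩ ⟨F', h1', h2', h3', h4'⟩
      refine ⟨image2 (· ∩ ·) F F', h1.image2 _ h1', ?_, ?_, ?_⟩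
      · rintro _ ⟨a, ha, b, hb, rfl⟩
        exact (h2 a ha).inter (h2' b hb)
      · intro x hx
        obtain ⟨a, ha, hxa⟩ := h3 hx
        obtain ⟨b, hb, hxb⟩ := h3' hx
        exact ⟨a ∩ b, ⟨a, ha, b, hb, rfl⟩, hxa, hxb⟩
      · rw [Set.disjoint_left] at h4 h4' ⊢
        rintro x ⟨_, ⟨a, ha, b, hb, rfl⟩, hxa, hxb⟩ (hx | hx)
        · exact h4 ⟨a, ha, hxa⟩ hx
        · exact h4' ⟨b, hb, hxb⟩ hx
    · intro w hw
      have hw' : w ∈ (closure O')ᶜ := fun h => hw (hO'O h)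
      obtain ⟨_, ⟨f, ⟨hf, hfS⟩, rfl⟩, hwf, hfO⟩ :=
        (isTopologicalBasis_of_subbasis hS.symm).exists_subset_of_mem_open hw'
          isClosed_closure.isOpen_compl
      refine ⟨⋂₀ f, mem_nhdsWithin_of_mem_nhds ?_, compl '' f, hf.image _, ?_, ?_, ?_⟩
      · exact ((isTopologicalBasis_of_subbasis hS.symm).isOpen ⟨f, ⟨hf, hfS⟩, rfl⟩).mem_nhds hwf
      · rintro _ ⟨s, hs, rfl⟩
        exact compl_mem (hfS hs)
      · rw [← compl_sInter]
        exact fun x hx hxf => hfO hxf (subset_closure hx)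
      · rw [← compl_sInter]
        exact disjoint_compl_left
  obtain ⟨F, hF, hFS, hOF, hFO⟩ := main
  refine ⟨{H ∈ F | z ∈ H}, hF.subset (sep_subset _ _), fun H hH => ⟨hFS H hH.1, hH.2, ?_⟩, ?_⟩
  · intro x hx
    by_contra hxO
    exact Set.disjoint_left.1 hFO ⟨H, hH.1, hx⟩ hxO
  · have hcl : IsClosed (⋃₀ {H ∈ F | z ∉ H}) := by
      rw [sUnion_eq_biUnion]
      exact (hF.subset (sep_subset _ _)).isClosed_biUnion fun H hH => (hFS H hH.1).isClosed hS
    have hzn : z ∉ ⋃₀ {H ∈ F | z ∉ H} := by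
      rintro ⟨H, hH, hzH⟩
      exact hH.2 hzH
    filter_upwards [hO'.mem_nhds hzO', hcl.isOpen_compl.mem_nhds hzn] with x hx hxn
    obtain ⟨H, hH, hxH⟩ := hOF hx
    refine ⟨H, ⟨hH, ?_⟩, hxH⟩
    by_contra hzH
    exact hxn ⟨H, ⟨hH, hzH⟩, hxH⟩

/-- If every point of a compact set has an open neighbourhood all of whose subsets satisfy `P`,
then the compact set is covered by finitely many convex sets satisfying `P`. -/
theorem exists_finite_cover [t : TopologicalSpace Z] [CompactSpace Z] [T2Space Z]
    (hS : generateFrom S = t) {K : Set Z} (hK : IsCompact K) {P : Set Z → Prop}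
    (hP : ∀ z ∈ K, ∃ O, IsOpen O ∧ z ∈ O ∧ ∀ H ⊆ O, P H) :
    ∃ F : Set (Set Z), F.Finite ∧ (∀ H ∈ F, IsSubbaseConvex S H ∧ P H) ∧ K ⊆ ⋃₀ F := by
  refine hK.induction_on
    (p := fun K => ∃ F : Set (Set Z), F.Finite ∧ (∀ H ∈ F, IsSubbaseConvex S H ∧ P H) ∧ K ⊆ ⋃₀ F)
    ?_ ?_ ?_ ?_
  · exact ⟨∅, by simp⟩
  · rintro s t hst ⟨F, h1, h2, h3⟩
    exact ⟨F, h1, h2, hst.trans h3⟩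
  · rintro s t ⟨F, h1, h2, h3⟩ ⟨F', h1', h2', h3'⟩
    refine ⟨F ∪ F', h1.union h1', ?_, ?_⟩
    · rintro H (h | h)
      exacts [h2 H h, h2' H h]
    · rw [sUnion_union]
      exact union_subset_union h3 h3'
  · intro z hz
    obtain ⟨O, hO, hzO, hOP⟩ := hP z hz
    obtain ⟨F, hF, hFH, hFz⟩ := exists_finite_nhds hS hO hzO
    exact ⟨⋃₀ F, mem_nhdsWithin_of_mem_nhds hFz, F, hF,
      fun H hH => ⟨(hFH H hH).1, hOP H (hFH H hH).2.2⟩, Subset.rfl⟩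

end IsSubbaseConvex

section Hyperspace

open unitInterval

theorem exists_lt_Icc_subset_of_isOpen {O : Set I} (hO : IsOpen O) (hne : O.Nonempty) :
    ∃ a b : I, a < b ∧ Icc a b ⊆ O := by
  obtain ⟨x, hx⟩ := hne
  obtain ⟨a, b, -, habx, hab⟩ := exists_Icc_mem_subset_of_mem_nhds (hO.mem_nhds hx)
  refine ⟨a, b, ?_, hab⟩
  by_contra hle
  exact infinite_of_mem_nhds x habx (subsingleton_Icc_of_ge (not_lt.1 hle)).finite

/-- Around any point of a set `C₀` in an open subset `𝓤` of the hyperspace there is an interval on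
which the trace of `C₀` can be replaced by an arbitrary nonempty finite set within `𝓤`. -/
theorem exists_Icc_union_mem_of_isOpen {𝓤 : Set (NonemptyCompacts I)} (h𝓤 : IsOpen 𝓤)
    {C₀ : NonemptyCompacts I} (hC₀ : C₀ ∈ 𝓤) {J : Set I} (hJ : IsOpen J)
    (hne : ((C₀ : Set I) ∩ J).Nonempty) :
    ∃ (K : Set I) (α β : I), α < β ∧ Icc α β ⊆ J ∧ Disjoint K (Icc α β) ∧
      ∀ W : Set I, W.Finite → W.Nonempty → W ⊆ Icc α β →
        ∃ C ∈ 𝓤, (C : Set I) = K ∪ W := by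
  obtain ⟨x₀, hxC, hxJ⟩ := hne
  obtain ⟨ε, hε, hball⟩ := Metric.isOpen_iff.1 h𝓤 C₀ hC₀
  obtain ⟨δ, hδ, hδJ⟩ := Metric.isOpen_iff.1 hJ x₀ hxJ
  obtain ⟨η, hη, hηδ, hηε⟩ : ∃ η > 0, η ≤ δ ∧ 2 * η < ε :=
    ⟨min δ (ε / 3), lt_min hδ (by positivity), min_le_left _ _, by
      have := min_le_right δ (ε / 3)
      linarith⟩
  obtain ⟨α, β, hlt, hαβ⟩ :=
    exists_lt_Icc_subset_of_isOpen Metric.isOpen_ball ⟨x₀, Metric.mem_ball_self hη⟩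
  refine ⟨(C₀ : Set I) \ Metric.ball x₀ η, α, β, hlt,
    hαβ.trans ((Metric.ball_subset_ball hηδ).trans hδJ), ?_, ?_⟩
  · exact disjoint_sdiff_left.mono_right hαβ
  intro W hW hWne hWI
  have hcl : IsCompact ((C₀ : Set I) \ Metric.ball x₀ η ∪ W) :=
    (C₀.isCompact.diff Metric.isOpen_ball).union hW.isCompact
  refine ⟨⟨⟨_, hcl⟩, hWne.mono subset_union_right⟩, hball ?_, rfl⟩
  rw [Metric.mem_ball, Metric.NonemptyCompacts.dist_eq]
  refine lt_of_le_of_lt (Metric.hausdorffDist_le_of_mem_dist (r := 2 * η) (by positivity) ?_ ?_) hηε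
  · rintro x (hx | hx)
    · exact ⟨x, hx.1, by simp [hη.le]⟩
    · refine ⟨x₀, hxC, ?_⟩
      have := Metric.mem_ball.1 (hαβ (hWI hx))
      linarith
  · intro x hx
    by_cases hxb : x ∈ Metric.ball x₀ η
    · obtain ⟨w, hw⟩ := hWne
      refine ⟨w, Or.inr hw, ?_⟩
      have h1 := Metric.mem_ball.1 (hαβ (hWI hw))
      have h2 := Metric.mem_ball.1 hxb
      linarith [dist_triangle_right x w x₀]
    · exact ⟨x, Or.inl ⟨hx, hxb⟩, by simp [hη.le]⟩

/-- The indexed family `Y`, restricted to `A`, is dense in some nonempty open subset of the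
hyperspace. -/
def SomewhereDense {D : Type*} (Y : D → Set I) (A : Set D) : Prop :=
  ¬ IsNowhereDense {C : NonemptyCompacts I | ∃ i ∈ A, (C : Set I) = Y i}

namespace SomewhereDense

variable {D : Type*} {Y : D → Set I} {A B : Set D}

theorem mono (h : SomewhereDense Y A) (hAB : A ⊆ B) : SomewhereDense Y B := fun hB =>
  h (hB.mono (by rintro C ⟨i, hi, hC⟩; exact ⟨i, hAB hi, hC⟩))

theorem of_union (h : SomewhereDense Y (A ∪ B)) : SomewhereDense Y A ∨ SomewhereDense Y B := by
  by_contra! hAB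
  obtain ⟨hA, hB⟩ := hAB
  simp only [SomewhereDense, not_not] at hA hB
  apply h
  have : {C : NonemptyCompacts I | ∃ i ∈ A ∪ B, (C : Set I) = Y i} =
      {C : NonemptyCompacts I | ∃ i ∈ A, (C : Set I) = Y i} ∪
      {C : NonemptyCompacts I | ∃ i ∈ B, (C : Set I) = Y i} := by
    ext C
    simp only [mem_union, mem_ofPred_eq, or_and_right, exists_or]
  rw [this, IsNowhereDense, closure_union,
    interior_union_isClosed_of_interior_empty isClosed_closure hB, hA]

theorem nonempty (h : SomewhereDense Y A) : A.Nonempty := by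
  by_contra hA
  rw [not_nonempty_iff_eq_empty] at hA
  subst hA
  exact h (by simp [IsNowhereDense])

theorem exists_mem_interior (h : SomewhereDense Y A) :
    ∃ (𝓤 : Set (NonemptyCompacts I)) (C₀ : NonemptyCompacts I), IsOpen 𝓤 ∧ C₀ ∈ 𝓤 ∧
      𝓤 ⊆ closure {C : NonemptyCompacts I | ∃ i ∈ A, (C : Set I) = Y i} ∧
      ∃ i ∈ A, (C₀ : Set I) = Y i := by
  obtain ⟨C, hC⟩ := nonempty_iff_ne_empty.2 h
  obtain ⟨C₀, hC₀, hi⟩ := mem_closure_iff.1 (interior_subset hC) _ isOpen_interior hC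
  exact ⟨_, C₀, isOpen_interior, hC₀, interior_subset, hi⟩

theorem not_finite (h : SomewhereDense Y A) : ¬ A.Finite := by
  intro hA
  have hfin : {C : NonemptyCompacts I | ∃ i ∈ A, (C : Set I) = Y i}.Finite := by
    refine Set.Finite.of_finite_image (f := ((↑) : NonemptyCompacts I → Set I))
      ((hA.image Y).subset ?_) SetLike.coe_injective.injOn
    rintro _ ⟨C, ⟨i, hi, hC⟩, rfl⟩
    exact ⟨i, hi, hC.symm⟩
  obtain ⟨𝓤, C₀, h𝓤, hC₀, hsub, -⟩ := h.exists_mem_interior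
  rw [hfin.isClosed.closure_eq] at hsub
  obtain ⟨K, α, β, hαβ, -, hK, hW⟩ := exists_Icc_union_mem_of_isOpen h𝓤 hC₀ isOpen_univ
    (by simpa using C₀.nonempty)
  choose! f hf𝓤 hf using fun w (hw : w ∈ Icc α β) =>
    hW {w} (finite_singleton w) (singleton_nonempty w) (by simpa using hw)
  refine (Icc_infinite hαβ).mono (fun w hw => hw) |>.image (f := f) ?_
    ((hfin.subset hsub).subset (image_subset_iff.2 hf𝓤))
  intro w hw w' hw' hww'
  have h1 : w ∈ K ∪ {w'} := by
    rw [← hf w' hw', ← hww', hf w hw]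
    exact Or.inr rfl
  rcases h1 with h1 | h1
  · exact absurd hw (Set.disjoint_left.1 hK h1)
  · exact h1

theorem diff_finite (h : SomewhereDense Y A) (hB : B.Finite) : SomewhereDense Y (A \ B) := by
  have : SomewhereDense Y (A \ B ∪ B) := h.mono (by simp)
  exact this.of_union.resolve_right fun h => h.not_finite hB

/-- If all members of a somewhere dense family meet the open set `J`, then for a suitable interval
in `J` the traces on that interval can be prescribed freely, keeping the family somewhere dense. -/
theorem exists_Icc (h : SomewhereDense Y A) {J : Set I} (hJ : IsOpen J)
    (hAJ : ∀ i ∈ A, (Y i ∩ J).Nonempty) :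
    ∃ α β : I, α < β ∧ Icc α β ⊆ J ∧ ∀ 𝒩 : Set (Set I), 𝒩.Finite → 𝒩.Nonempty →
      (∀ N ∈ 𝒩, IsOpen N ∧ N.Nonempty ∧ N ⊆ Icc α β) →
      SomewhereDense Y {i ∈ A | (∀ N ∈ 𝒩, (Y i ∩ N).Nonempty) ∧ Y i ∩ Icc α β ⊆ ⋃₀ 𝒩} := by
  obtain ⟨𝓤, C₀, h𝓤, hC₀, hsub, i₀, hi₀, hCi₀⟩ := h.exists_mem_interior
  obtain ⟨K, α, β, hαβ, hαβJ, hK, hW⟩ := exists_Icc_union_mem_of_isOpen h𝓤 hC₀ hJ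
    (hCi₀ ▸ hAJ i₀ hi₀)
  refine ⟨α, β, hαβ, hαβJ, fun 𝒩 hfin hne h𝒩 => ?_⟩
  choose! y hy using fun N hN => (h𝒩 N hN).2.1
  obtain ⟨C, hC𝓤, hC⟩ := hW (y '' 𝒩) (hfin.image y) (hne.image y)
    (image_subset_iff.2 fun N hN => (h𝒩 N hN).2.2 (hy N hN))
  set 𝓥 : Set (NonemptyCompacts I) := 𝓤 ∩ ({C | (C : Set I) ⊆ (Icc α β)ᶜ ∪ ⋃₀ 𝒩} ∩
    ⋂ N ∈ 𝒩, {C | ((C : Set I) ∩ N).Nonempty})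
  have h𝓥 : IsOpen 𝓥 := h𝓤.inter <| (NonemptyCompacts.isOpen_subsets_of_isOpen
    (isClosed_Icc.isOpen_compl.union (isOpen_sUnion fun N hN => (h𝒩 N hN).1))).inter <|
    hfin.isOpen_biInter fun N hN => NonemptyCompacts.isOpen_inter_nonempty_of_isOpen (h𝒩 N hN).1
  have hC𝓥 : C ∈ 𝓥 := by
    refine ⟨hC𝓤, ?_, ?_⟩
    · change (C : Set I) ⊆ _
      rw [hC]
      rintro x (hx | ⟨N, hN, rfl⟩)
      · exact Or.inl (Set.disjoint_left.1 hK hx)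
      · exact Or.inr ⟨N, hN, hy N hN⟩
    · simp only [mem_iInter, mem_ofPred_eq]
      intro N hN
      exact ⟨y N, by rw [hC]; exact Or.inr ⟨N, hN, rfl⟩, hy N hN⟩
  refine Set.Nonempty.ne_empty ⟨C, mem_interior.2 ⟨𝓥, fun C' hC' => ?_, h𝓥, hC𝓥⟩⟩
  rw [mem_closure_iff]
  intro o ho hC'o
  obtain ⟨C'', ⟨hC''o, hC''⟩, i, hi, hiC⟩ :=
    mem_closure_iff.1 (hsub hC'.1) _ (ho.inter h𝓥) ⟨hC'o, hC'⟩
  refine ⟨C'', hC''o, i, ⟨hi, ?_, ?_⟩, hiC⟩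
  · rw [← hiC]
    simpa using hC''.2.2
  · rw [← hiC]
    rintro x ⟨hx, hxI⟩
    exact (hC''.2.1 hx).resolve_left fun h => h hxI

end SomewhereDense

end Hyperspace

section Levels

open unitInterval OnePoint

variable {Z D : Type*} {S : Set (Set Z)} {π : Z → I} {q : Z → OnePoint D}

/-- The image under `π` of the part of `F` lying over the point `i` of `D`. -/
def levelTrace (π : Z → I) (q : Z → OnePoint D) (F : Set Z) (i : D) : Set I :=
  π '' (F ∩ q ⁻¹' {(i : OnePoint D)})

theorem levelTrace_inter_nonempty {F : Set Z} {i : D} {J : Set I} :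
    (levelTrace π q F i ∩ J).Nonempty ↔ ∃ z ∈ F, q z = i ∧ π z ∈ J := by
  constructor
  · rintro ⟨_, ⟨z, ⟨hzF, hz⟩, rfl⟩, hzJ⟩
    exact ⟨z, hzF, hz, hzJ⟩
  · rintro ⟨z, hzF, hz, hzJ⟩
    exact ⟨π z, ⟨z, ⟨hzF, hz⟩, rfl⟩, hzJ⟩

/-- `F` is full on `J` for the levels in `A` if, up to nowhere dense families of sections, `F`
meets every open part of `J` that the section meets. -/
def IsFullOn (π : Z → I) (q : Z → OnePoint D) (F : Set Z) (A : Set D) (J : Set I) : Prop :=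
  ∀ J' ⊆ J, IsOpen J' → ¬ SomewhereDense (levelTrace π q univ)
    {i ∈ A | (levelTrace π q univ i ∩ J').Nonempty ∧ ¬ (levelTrace π q F i ∩ J').Nonempty}

theorem IsFullOn.mono {F : Set Z} {A B : Set D} {J J' : Set I} (h : IsFullOn π q F A J)
    (hB : B ⊆ A) (hJ : J' ⊆ J) : IsFullOn π q F B J' := fun K hK hKo hd =>
  h K (hK.trans hJ) hKo (hd.mono fun _ hi => ⟨hB hi.1, hi.2⟩)

theorem isFullOn_univ (A : Set D) (J : Set I) : IsFullOn π q univ A J := by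
  intro J' _ _ hd
  obtain ⟨i, -, h1, h2⟩ := hd.nonempty
  exact h2 h1

/-- Among finitely many sets covering the space, one becomes full after shrinking. -/
theorem IsFullOn.exists_inter {F : Set Z} {A : Set D} {N : Set I} (h : IsFullOn π q F A N)
    (hA : SomewhereDense (levelTrace π q univ) A) (hN : IsOpen N)
    (hAN : ∀ i ∈ A, (levelTrace π q univ i ∩ N).Nonempty)
    {𝓕 : Set (Set Z)} (h𝓕 : 𝓕.Finite) (hcov : univ ⊆ ⋃₀ 𝓕) :
    ∃ H ∈ 𝓕, ∃ N' ⊆ N, ∃ A' ⊆ A, IsOpen N' ∧ SomewhereDense (levelTrace π q univ) A' ∧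
      (∀ i ∈ A', (levelTrace π q univ i ∩ N').Nonempty) ∧ IsFullOn π q (F ∩ H) A' N' := by
  have key : (∃ H ∈ 𝓕, ∃ N' ⊆ N, ∃ A' ⊆ A, IsOpen N' ∧ SomewhereDense (levelTrace π q univ) A' ∧
      (∀ i ∈ A', (levelTrace π q univ i ∩ N').Nonempty) ∧ IsFullOn π q (F ∩ H) A' N') ∨
      ∃ N' ⊆ N, ∃ A' ⊆ A, IsOpen N' ∧ SomewhereDense (levelTrace π q univ) A' ∧
      (∀ i ∈ A', (levelTrace π q univ i ∩ N').Nonempty) ∧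
      ∀ H ∈ 𝓕, ∀ i ∈ A', ¬ (levelTrace π q (F ∩ H) i ∩ N').Nonempty := by
    clear hcov
    induction 𝓕, h𝓕 using Set.Finite.induction_on with
    | empty => exact Or.inr ⟨N, Subset.rfl, A, Subset.rfl, hN, hA, hAN, by simp⟩
    | @insert H 𝓕 _ _ ih =>
      rcases ih with ⟨H', hH', h⟩ | ⟨N', hN', A', hA', hN'o, hA'd, hlive, hdis⟩
      · exact Or.inl ⟨H', Or.inr hH', h⟩
      by_cases hfull : IsFullOn π q (F ∩ H) A' N'
      · exact Or.inl ⟨H, Or.inl rfl, N', hN', A', hA', hN'o, hA'd, hlive, hfull⟩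
      simp only [IsFullOn, not_forall, not_not] at hfull
      obtain ⟨J', hJ', hJ'o, hd⟩ := hfull
      refine Or.inr ⟨J', hJ'.trans hN', _, (sep_subset _ _).trans hA', hJ'o, hd,
        fun i hi => hi.2.1, ?_⟩
      rintro K (rfl | hK) i hi
      · exact hi.2.2
      · exact fun hne => hdis K hK i hi.1 (hne.mono (inter_subset_inter_right _ hJ'))
  refine key.resolve_right ?_
  rintro ⟨N', hN', A', hA', hN'o, hA'd, hlive, hdis⟩
  refine h N' hN' hN'o (hA'd.mono fun i hi => ⟨hA' hi, hlive i hi, fun hne => ?_⟩)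
  obtain ⟨z, hzF, hzi, hzN⟩ := levelTrace_inter_nonempty.1 hne
  obtain ⟨H, hH, hzH⟩ := hcov (mem_univ z)
  exact hdis H hH i hi (levelTrace_inter_nonempty.2 ⟨z, ⟨hzF, hzH⟩, hzi, hzN⟩)

variable [TopologicalSpace D] [DiscreteTopology D] [t : TopologicalSpace Z] [CompactSpace Z]

/-- A closed set that avoids the fibre over `∞` meets only finitely many levels. -/
theorem finite_setOf_levels (hq : Continuous q) {E : Set Z} (hE : IsClosed E)
    (h : ∀ z ∈ E, q z ≠ ∞) : {i : D | ∃ z ∈ E, q z = i}.Finite := by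
  rw [← isCompact_iff_finite]
  refine (OnePoint.isOpen_compl_image_coe.1 ?_).2
  have : ((↑) : D → OnePoint D) '' {i : D | ∃ z ∈ E, q z = i} = q '' E := by
    ext x
    constructor
    · rintro ⟨i, ⟨z, hz, hzi⟩, rfl⟩
      exact ⟨z, hz, hzi⟩
    · rintro ⟨z, hz, rfl⟩
      obtain ⟨i, hi⟩ := OnePoint.ne_infty_iff_exists.1 (h z hz)
      exact ⟨i, ⟨z, hz, hi.symm⟩, hi⟩
  rw [this]
  exact (hE.isCompact.image hq).isClosed.isOpen_compl

variable [T2Space Z]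

/-- Every level is a finite union of convex sets. -/
theorem exists_finite_convex_cover_level (hS : generateFrom S = t) (hq : Continuous q) (i : D) :
    ∃ 𝓖 : Set (Set Z), 𝓖.Finite ∧
      (∀ G ∈ 𝓖, IsSubbaseConvex S G ∧ G ⊆ q ⁻¹' {(i : OnePoint D)}) ∧
      q ⁻¹' {(i : OnePoint D)} ⊆ ⋃₀ 𝓖 := by
  have hopen : IsOpen ({(i : OnePoint D)} : Set (OnePoint D)) := by
    rw [← image_singleton, OnePoint.isOpen_image_coe]
    exact isOpen_discrete _
  exact IsSubbaseConvex.exists_finite_cover hS (isClosed_singleton.preimage hq).isCompact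
    fun z hz => ⟨_, hopen.preimage hq, hz, fun H hH => hH⟩

/-- Right of a point `zp` over `∞` there is an open set of abscissas over which almost all levels
avoid `E` and are covered by convex sets through `zp` that stay over `U`. -/
theorem exists_isOpen_levels_subset (hS : generateFrom S = t) (hπ : Continuous π)
    (hq : Continuous q) (hinj : ∀ z z', π z = π z' → q z = q z' → z = z')
    {E : Set Z} (hE : IsClosed E) {zp : Z} (hzp : q zp = ∞)
    (hEp : ∀ z ∈ E, q z = ∞ → π z ≤ π zp) {U : Set I} (hU : IsOpen U) (hpU : π zp ∈ U)
    {β : I} (hβ : π zp < β) :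
    ∃ N : Set I, IsOpen N ∧ N.Nonempty ∧ N ⊆ U ∩ Ioo (π zp) β ∧ ∃ 𝓗 : Set (Set Z),
      (∀ H ∈ 𝓗, IsSubbaseConvex S H ∧ zp ∈ H ∧ H ⊆ π ⁻¹' U) ∧ ∃ B : Set D, B.Finite ∧
      ∀ i ∉ B, ∀ z, q z = (i : OnePoint D) → π z ∈ N → z ∉ E ∧ z ∈ ⋃₀ 𝓗 := by
  obtain ⟨𝓗, -, h𝓗, hnhds⟩ := IsSubbaseConvex.exists_finite_nhds hS (hU.preimage hπ) hpU
  have hE' : IsClosed (interior (⋃₀ 𝓗))ᶜ := isOpen_interior.isClosed_compl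
  have hcl : IsClosed (π '' ((interior (⋃₀ 𝓗))ᶜ ∩ q ⁻¹' {∞})) :=
    ((hE'.inter (isClosed_singleton.preimage hq)).isCompact.image hπ).isClosed
  have hp : π zp ∉ π '' ((interior (⋃₀ 𝓗))ᶜ ∩ q ⁻¹' {∞}) := by
    rintro ⟨z, ⟨hz, hz'⟩, hzπ⟩
    rw [hinj z zp hzπ (hz'.trans hzp.symm)] at hz
    exact hz (mem_interior_iff_mem_nhds.2 hnhds)
  have hpcl : π zp ∈ closure (Ioo (π zp) β) := by
    rw [closure_Ioo hβ.ne]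
    exact left_mem_Icc.2 hβ.le
  have hO := hcl.isOpen_compl.inter hU
  obtain ⟨a, b, hab, hsub⟩ := exists_lt_Icc_subset_of_isOpen (hO.inter isOpen_Ioo)
    (mem_closure_iff.1 hpcl _ hO ⟨hp, hpU⟩)
  refine ⟨Ioo a b, isOpen_Ioo, nonempty_Ioo.2 hab,
    fun x hx => ⟨(hsub (Ioo_subset_Icc_self hx)).1.2, (hsub (Ioo_subset_Icc_self hx)).2⟩,
    𝓗, h𝓗, _, finite_setOf_levels hq
      ((hE.union hE').inter ((isClosed_Icc (a := a) (b := b)).preimage hπ)) ?_, ?_⟩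
  · rintro z ⟨hz, hzI⟩ hz'
    rcases hz with hz | hz
    · exact (hsub hzI).2.1.not_ge (hEp z hz hz')
    · exact (hsub hzI).1.1 ⟨z, ⟨hz, hz'⟩, rfl⟩
  · intro i hi z hzi hzN
    by_contra hcon
    refine hi ⟨z, ⟨?_, Ioo_subset_Icc_self hzN⟩, hzi⟩
    by_contra hzu
    rw [mem_union, not_or, notMem_compl_iff] at hzu
    exact hcon ⟨hzu.1, interior_subset hzu.2⟩

/-- Every somewhere dense family of levels on which a convex set `F` is full can be shrunk
so that `F` meets at least `r` pieces over `J` of each level. -/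
theorem exists_subset_le_ncard (hS : generateFrom S = t)
    (hbin : ∀ C ⊆ S, ⋃₀ C = univ → ∃ T ⊆ C, T.Finite ∧ T.ncard ≤ 2 ∧ ⋃₀ T = univ)
    (hπ : Continuous π) (hq : Continuous q)
    (hinj : ∀ z z', π z = π z' → q z = q z' → z = z')
    {𝓖 : D → Set (Set Z)} (h𝓖fin : ∀ i, (𝓖 i).Finite)
    (h𝓖 : ∀ i, ∀ G ∈ 𝓖 i, IsSubbaseConvex S G ∧ G ⊆ q ⁻¹' {(i : OnePoint D)})
    (h𝓖cov : ∀ i : D, q ⁻¹' {(i : OnePoint D)} ⊆ ⋃₀ 𝓖 i) (r : ℕ) :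
    ∀ (A : Set D) (J : Set I) (F : Set Z), SomewhereDense (levelTrace π q univ) A → IsOpen J →
      (∀ i ∈ A, (levelTrace π q univ i ∩ J).Nonempty) → IsSubbaseConvex S F →
      IsFullOn π q F A J →
      ∃ A' ⊆ A, SomewhereDense (levelTrace π q univ) A' ∧
        ∀ i ∈ A', r ≤ {G ∈ 𝓖 i | (G ∩ F ∩ π ⁻¹' J).Nonempty}.ncard := by
  induction r with
  | zero => exact fun A J F hA _ _ _ _ => ⟨A, Subset.rfl, hA, by simp⟩
  | succ r ih =>
  intro A J F hA hJ hAJ hF hfull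
  obtain ⟨α, β, hαβ, hαβJ, hpres⟩ := hA.exists_Icc hJ hAJ
  obtain ⟨m, hαm, hmβ⟩ := exists_between hαβ
  obtain ⟨α', hαα', hα'm⟩ := exists_between hαm
  obtain ⟨𝓕, h𝓕, h𝓕P, h𝓕cov⟩ := IsSubbaseConvex.exists_finite_cover hS
    (isCompact_univ (X := Z)) (P := fun H => H ⊆ π ⁻¹' Iio β ∨ H ⊆ π ⁻¹' Ioi m) fun z _ => by
      rcases lt_or_ge (π z) β with h | h
      · exact ⟨_, isOpen_Iio.preimage hπ, h, fun H hH => Or.inl hH⟩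
      · exact ⟨_, isOpen_Ioi.preimage hπ, hmβ.trans_le h, fun H hH => Or.inr hH⟩
  have hFcl : IsClosed F := hF.isClosed hS
  have hHcl : ∀ H ∈ 𝓕, IsClosed (F ∩ H) := fun H hH => hFcl.inter ((h𝓕P H hH).1.isClosed hS)
  have hclinf : IsClosed (q ⁻¹' {∞}) := isClosed_singleton.preimage hq
  have hclI : IsClosed (π ⁻¹' Icc α' m) := isClosed_Icc.preimage hπ
  -- the members of the cover which reach the fibre over `∞` inside `Icc α' m`
  set good : Set (Set Z) := {H ∈ 𝓕 | (F ∩ H ∩ q ⁻¹' {∞} ∩ π ⁻¹' Icc α' m).Nonempty}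
  have hgoodfin : good.Finite := h𝓕.subset (sep_subset _ _)
  have hmax : ∀ H ∈ good, ∃ z ∈ F ∩ H, q z = ∞ ∧ α' ≤ π z ∧ π z < β ∧
      ∀ z' ∈ F ∩ H, q z' = ∞ → π z' ≤ π z := by
    rintro H ⟨hH, w, ⟨⟨hwF, hwinf⟩, hwI⟩⟩
    obtain ⟨z, hz, hzmax⟩ := ((hHcl H hH).inter hclinf).isCompact.exists_isMaxOn ⟨w, hwF, hwinf⟩
      hπ.continuousOn
    refine ⟨z, hz.1, hz.2, hwI.1.trans (hzmax ⟨hwF, hwinf⟩), ?_, fun z' h1 h2 => hzmax ⟨h1, h2⟩⟩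
    rcases (h𝓕P H hH).2 with h | h
    · exact h hz.1.2
    · exact absurd (h hwF.2) (not_lt.2 hwI.2)
  have : Nonempty Z := by
    obtain ⟨i, hi⟩ := hA.nonempty
    obtain ⟨z, -⟩ := levelTrace_inter_nonempty.1 (hAJ i hi)
    exact ⟨z⟩
  choose! zt hztF hztinf hztα hztβ hztmax using hmax
  obtain ⟨y₀, hy₀I, hy₀⟩ : ∃ y ∈ Ioo α' m, y ∉ (fun H => π (zt H)) '' good :=
    ((Ioo_infinite hα'm).sdiff (hgoodfin.image _)).nonempty
  obtain ⟨U, hU, hUdis⟩ := ((hgoodfin.image fun H => π (zt H)).insert y₀).t2_separation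
  have hpack : ∀ H ∈ good, ∃ N : Set I, IsOpen N ∧ N.Nonempty ∧
      N ⊆ U (π (zt H)) ∩ Ioo α β ∩ Ioo (π (zt H)) β ∧ ∃ 𝓗 : Set (Set Z),
      (∀ K ∈ 𝓗, IsSubbaseConvex S K ∧ zt H ∈ K ∧ K ⊆ π ⁻¹' (U (π (zt H)) ∩ Ioo α β)) ∧
      ∃ B : Set D, B.Finite ∧ ∀ i ∉ B, ∀ z, q z = (i : OnePoint D) → π z ∈ N →
        z ∉ ⋃ K ∈ {K ∈ good | π (zt K) = π (zt H)}, F ∩ K ∧ z ∈ ⋃₀ 𝓗 := by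
    intro H hH
    refine exists_isOpen_levels_subset hS hπ hq hinj ?_ (hztinf H hH) ?_ ((hU _).2.inter isOpen_Ioo)
      ⟨(hU _).1, hαα'.trans_le (hztα H hH), hztβ H hH⟩ (hztβ H hH)
    · exact (hgoodfin.subset (sep_subset _ _)).isClosed_biUnion fun K hK => hHcl K hK.1.1
    · intro z hz hzinf
      simp only [mem_iUnion] at hz
      obtain ⟨K, ⟨hK, hKH⟩, hzK⟩ := hz
      exact hKH ▸ hztmax K hK z hzK hzinf
  choose! N hNo hNne hNsub 𝓗 h𝓗 B hB hBN using hpack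
  set N₀ : Set I := U y₀ ∩ Ioo α' m
  have hN₀o : IsOpen N₀ := (hU y₀).2.inter isOpen_Ioo
  have hN₀I : N₀ ⊆ Icc α β := fun x hx => ⟨(hαα'.trans hx.2.1).le, (hx.2.2.trans hmβ).le⟩
  have hNI : ∀ H ∈ good, N H ⊆ Icc α β := fun H hH x hx =>
    Ioo_subset_Icc_self (hNsub H hH hx).1.2
  have hd := hpres (insert N₀ (N '' good)) ((hgoodfin.image N).insert N₀) (insert_nonempty _ _) (by
    rintro _ (rfl | ⟨H, hH, rfl⟩)
    · exact ⟨hN₀o, ⟨y₀, (hU y₀).1, hy₀I⟩, hN₀I⟩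
    · exact ⟨hNo H hH, hNne H hH, hNI H hH⟩)
  set Bad : Set D := (⋃ H ∈ 𝓕 \ good, {i : D | ∃ z ∈ F ∩ H ∩ π ⁻¹' Icc α' m, q z = i}) ∪
    ⋃ H ∈ good, B H
  have hBadfin : Bad.Finite := by
    refine Set.Finite.union ?_ (hgoodfin.biUnion hB)
    refine (h𝓕.subset sdiff_subset).biUnion fun H hH => ?_
    refine finite_setOf_levels hq ((hHcl H hH.1).inter hclI) fun z hz hzinf => hH.2 ⟨hH.1, z, ?_⟩
    exact ⟨⟨hz.1, hzinf⟩, hz.2⟩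
  have hd₁ := hd.diff_finite hBadfin
  set A₁ := {i ∈ A | (∀ N' ∈ insert N₀ (N '' good), (levelTrace π q univ i ∩ N').Nonempty) ∧
    levelTrace π q univ i ∩ Icc α β ⊆ ⋃₀ insert N₀ (N '' good)} \ Bad
  obtain ⟨H, hH, N', hN'N, A₂, hA₂A, hN'o, hA₂d, hA₂live, hA₂full⟩ :=
    (hfull.mono (fun i hi => hi.1.1) (hN₀I.trans hαβJ) : IsFullOn π q F A₁ N₀).exists_inter hd₁
      hN₀o (fun i hi => hi.1.2.1 _ (Or.inl rfl)) h𝓕 h𝓕cov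
  have hHgood : H ∈ good := by
    by_contra hHbad
    refine hA₂full N' Subset.rfl hN'o (hA₂d.mono fun i hi => ⟨hi, hA₂live i hi, fun hne => ?_⟩)
    obtain ⟨z, hzF, hzi, hzN⟩ := levelTrace_inter_nonempty.1 hne
    refine (hA₂A hi).2 (Or.inl (mem_biUnion (show H ∈ 𝓕 \ good from ⟨hH, hHbad⟩) ?_))
    exact ⟨z, ⟨hzF, Ioo_subset_Icc_self (hN'N hzN).2⟩, hzi⟩
  obtain ⟨A₃, hA₃A, hA₃d, hA₃⟩ := ih A₂ N' (F ∩ H) hA₂d hN'o hA₂live (hF.inter (h𝓕P H hH).1) hA₂full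
  refine ⟨{i ∈ A₃ | (levelTrace π q F i ∩ N H).Nonempty},
    fun i hi => (hA₂A (hA₃A hi.1)).1.1, ?_, ?_⟩
  · have hsub : A₃ ⊆ {i ∈ A₃ | (levelTrace π q F i ∩ N H).Nonempty} ∪
        {i ∈ A | (levelTrace π q univ i ∩ N H).Nonempty ∧
          ¬ (levelTrace π q F i ∩ N H).Nonempty} := by
      intro i hi
      have hi₁ := hA₂A (hA₃A hi)
      by_cases hne : (levelTrace π q F i ∩ N H).Nonempty
      · exact Or.inl ⟨hi, hne⟩
      · exact Or.inr ⟨hi₁.1.1, hi₁.1.2.1 _ (Or.inr ⟨H, hHgood, rfl⟩), hne⟩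
    exact (hA₃d.mono hsub).of_union.resolve_right
      (hfull _ ((hNI H hHgood).trans hαβJ) (hNo H hHgood))
  rintro i ⟨hi₃, hne⟩
  have hi₁ := hA₂A (hA₃A hi₃)
  have hiB : ∀ K ∈ good, i ∉ B K := fun K hK hi => hi₁.2 (Or.inr (mem_biUnion hK hi))
  obtain ⟨z, hzF, hzi, hzN⟩ := levelTrace_inter_nonempty.1 hne
  obtain ⟨-, K, hK, hzK⟩ := hBN H hHgood i (hiB H hHgood) z hzi hzN
  obtain ⟨hKconv, hztK, hKU⟩ := h𝓗 H hHgood K hK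
  obtain ⟨G, hG, hzG⟩ := h𝓖cov i hzi
  have hGnew : G ∉ {G ∈ 𝓖 i | (G ∩ (F ∩ H) ∩ π ⁻¹' N').Nonempty} := by
    rintro ⟨-, w, ⟨hwG, hwFH⟩, -⟩
    obtain ⟨v, ⟨⟨hvF, hvH⟩, -, hvK⟩, hvG⟩ := IsSubbaseConvex.nonempty_inter_inter hbin
      (hF.inter (h𝓕P H hH).1) (hF.inter hKconv) (h𝓖 i G hG).1
      ⟨zt H, hztF H hHgood, (hztF H hHgood).1, hztK⟩ ⟨w, hwFH, hwG⟩ ⟨z, ⟨hzF, hzK⟩, hzG⟩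
    have hvi : q v = i := (h𝓖 i G hG).2 hvG
    obtain ⟨hvU, hvI⟩ := hKU hvK
    obtain ⟨_, (rfl | ⟨H', hH', rfl⟩), hvN⟩ := hi₁.1.2.2
      ⟨⟨v, ⟨mem_univ v, hvi⟩, rfl⟩, Ioo_subset_Icc_self hvI⟩
    · refine Set.disjoint_left.1 (hUdis (Or.inl rfl) (Or.inr ⟨H, hHgood, rfl⟩) ?_) hvN.1 hvU
      rintro h
      exact hy₀ ⟨H, hHgood, h.symm⟩
    · have heq : π (zt H) = π (zt H') := by
        by_contra hne
        exact Set.disjoint_left.1 (hUdis (Or.inr ⟨H, hHgood, rfl⟩) (Or.inr ⟨H', hH', rfl⟩) hne)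
          hvU (hNsub H' hH' hvN).1.1
      exact (hBN H' hH' i (hiB H' hH') v hvi hvN).1 (mem_biUnion
        (show H ∈ {K ∈ good | π (zt K) = π (zt H')} from ⟨hHgood, heq⟩) ⟨hvF, hvH⟩)
  have hfin : {G ∈ 𝓖 i | (G ∩ (F ∩ H) ∩ π ⁻¹' N').Nonempty}.Finite :=
    (h𝓖fin i).subset (sep_subset _ _)
  calc r + 1 ≤ {G ∈ 𝓖 i | (G ∩ (F ∩ H) ∩ π ⁻¹' N').Nonempty}.ncard + 1 :=
        Nat.succ_le_succ (hA₃ i hi₃)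
    _ = (insert G {G ∈ 𝓖 i | (G ∩ (F ∩ H) ∩ π ⁻¹' N').Nonempty}).ncard :=
        (ncard_insert_of_notMem hGnew hfin).symm
    _ ≤ _ := by
        refine ncard_le_ncard ?_ ((h𝓖fin i).subset (sep_subset _ _))
        rintro _ (rfl | ⟨hG', w, ⟨hwG, hwF, -⟩, hwN⟩)
        · exact ⟨hG, z, ⟨hzG, hzF⟩, hαβJ (hNI H hHgood hzN)⟩
        · exact ⟨hG', w, ⟨hwG, hwF⟩, hαβJ (hN₀I (hN'N hwN))⟩

end Levels

/-- If a closed subspace `X` of the product `𝕀 × αD` of the unit interval and the one-point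
compactification of a discrete space `D` is supercompact, then the family of its sections
`{X_i : i ∈ D}` is meager in the hyperspace `exp 𝕀` of nonempty closed subsets of `𝕀`
(with the Vietoris topology, equivalently the topology of the Hausdorff metric). -/
theorem sections_meager_of_supercompact
    (D : Type u) [TopologicalSpace D] [DiscreteTopology D]
    (X : Set (unitInterval × OnePoint D)) (hX : IsClosed X)
    (hsc : IsSupercompact X) :
    IsMeagre {C : TopologicalSpace.NonemptyCompacts unitInterval |
      ∃ i : D, (C : Set unitInterval) = {x | (x, (i : OnePoint D)) ∈ X}} := by
  obtain ⟨S, hS, hbin⟩ := hsc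
  have : CompactSpace X := isCompact_iff_compactSpace.1 hX.isCompact
  set π : X → unitInterval := fun z => z.1.1
  set q : X → OnePoint D := fun z => z.1.2
  have hπ : Continuous π := continuous_fst.comp continuous_subtype_val
  have hq : Continuous q := continuous_snd.comp continuous_subtype_val
  have hinj : ∀ z z', π z = π z' → q z = q z' → z = z' := fun z z' h1 h2 =>
    Subtype.ext (Prod.ext h1 h2)
  have htrace : ∀ i : D, levelTrace π q univ i = {x | (x, (i : OnePoint D)) ∈ X} := by
    intro i
    ext x
    constructor
    · rintro ⟨⟨⟨x, j⟩, hz⟩, ⟨-, hj⟩, rfl⟩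
      obtain rfl : j = i := hj
      exact hz
    · intro hx
      exact ⟨⟨(x, i), hx⟩, ⟨mem_univ _, rfl⟩, rfl⟩
  choose 𝓖 h𝓖fin h𝓖 h𝓖cov using exists_finite_convex_cover_level hS hq
  set L : ℕ → Set D := fun n =>
    {i | (𝓖 i).ncard ≤ n ∧ (levelTrace π q univ i).Nonempty}
  have hsub : {C : TopologicalSpace.NonemptyCompacts unitInterval |
      ∃ i : D, (C : Set unitInterval) = {x | (x, (i : OnePoint D)) ∈ X}} ⊆
      ⋃ n, {C : NonemptyCompacts unitInterval |
        ∃ i ∈ L n, (C : Set unitInterval) = levelTrace π q univ i} := by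
    rintro C ⟨i, hC⟩
    rw [← htrace i] at hC
    exact mem_iUnion.2 ⟨(𝓖 i).ncard, i, ⟨le_rfl, hC ▸ C.nonempty⟩, hC⟩
  refine IsMeagre.mono hsub (isMeagre_iUnion fun n => IsNowhereDense.isMeagre ?_)
  by_contra hd
  obtain ⟨A, hAL, hAd, hA⟩ := exists_subset_le_ncard hS hbin hπ hq hinj h𝓖fin h𝓖 h𝓖cov (n + 1)
    (L n) univ univ hd isOpen_univ (fun i hi => by simpa using hi.2) (IsSubbaseConvex.univ S)
    (isFullOn_univ _ _)
  obtain ⟨i, hi⟩ := hAd.nonempty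
  have h1 := hA i hi
  have h2 := ncard_le_ncard (sep_subset (𝓖 i) fun G => (G ∩ univ ∩ π ⁻¹' univ).Nonempty) (h𝓖fin i)
  have h3 := (hAL hi).1
  omega
end

section
/- Let K be a compact metrizable space, D a discrete space, and X ⊆ K × αD a closed subspace. Then the following conditions are equivalent: (1) X is hereditarily paracompact; (2) X is hereditarily normal; (3) the indexed family of sections {X_i : i ∈ D} is weakly nwd-countable in K. -/
open Set Topology TopologicalSpace

universe u v

/-- Paracompactness of all open subspaces is inherited by arbitrary subspaces. -/
theorem paracompactSpace_subtype_of_forall_isOpen {Z : Type*} [TopologicalSpace Z]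
    (h : ∀ G : Set Z, IsOpen G → ParacompactSpace G) (A : Set Z) : ParacompactSpace A where
  locallyFinite_refinement α s ho hu := by
    choose U hUo hU using fun a ↦ isOpen_induced_iff.1 (ho a)
    have hG : IsOpen (⋃ a, U a) := isOpen_iUnion hUo
    have := h _ hG
    have hA : ∀ x : A, (x : Z) ∈ ⋃ a, U a := by
      intro x
      obtain ⟨a, ha⟩ := iUnion_eq_univ_iff.1 hu x
      rw [← hU a] at ha
      exact mem_iUnion.2 ⟨a, ha⟩
    let e : A → (⋃ a, U a : Set Z) := fun x ↦ ⟨x, hA x⟩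
    have he : Continuous e := continuous_subtype_val.subtype_mk _
    obtain ⟨t, hto, htu, htf, hts⟩ := precise_refinement
      (fun a ↦ (Subtype.val ⁻¹' U a : Set (⋃ a, U a : Set Z)))
      (fun a ↦ (hUo a).preimage continuous_subtype_val)
      (by rw [← preimage_iUnion, Subtype.coe_preimage_self])
    refine ⟨α, fun a ↦ e ⁻¹' t a, fun a ↦ (hto a).preimage he, ?_,
      htf.preimage_continuous he, fun a ↦ ⟨a, ?_⟩⟩
    · rw [← preimage_iUnion, htu, preimage_univ]
    · intro x hx
      rw [← hU a]
      exact hts a hx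

/-- A space partitioned into open paracompact subspaces is paracompact. -/
theorem ParacompactSpace.of_pairwise_disjoint_isOpen {Z ι : Type*} [TopologicalSpace Z]
    {W : ι → Set Z} (hWo : ∀ j, IsOpen (W j)) (hWd : Pairwise fun j k ↦ Disjoint (W j) (W k))
    (hWu : ⋃ j, W j = univ) (hW : ∀ j, ParacompactSpace (W j)) : ParacompactSpace Z where
  locallyFinite_refinement α s ho hu := by
    have key (j : ι) := precise_refinement (fun a ↦ (Subtype.val ⁻¹' s a : Set (W j)))
      (fun a ↦ (ho a).preimage continuous_subtype_val)
      (by rw [← preimage_iUnion, hu, preimage_univ])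
    choose t hto htu htf hts using key
    refine ⟨α, fun a ↦ ⋃ j, Subtype.val '' t j a, fun a ↦ isOpen_iUnion fun j ↦
      (hWo j).isOpenMap_subtype_val _ (hto j a), ?_, fun x ↦ ?_, fun a ↦ ⟨a, ?_⟩⟩
    · refine iUnion_eq_univ_iff.2 fun x ↦ ?_
      obtain ⟨j, hj⟩ := iUnion_eq_univ_iff.1 hWu x
      obtain ⟨a, ha⟩ := iUnion_eq_univ_iff.1 (htu j) ⟨x, hj⟩
      exact ⟨a, mem_iUnion.2 ⟨j, _, ha, rfl⟩⟩
    · obtain ⟨j, hj⟩ := iUnion_eq_univ_iff.1 hWu x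
      obtain ⟨N, hN, hf⟩ := htf j ⟨x, hj⟩
      refine ⟨Subtype.val '' N, (hWo j).isOpenMap_subtype_val.image_mem_nhds hN,
        hf.subset ?_⟩
      rintro a ⟨_, hy, ⟨z, hz, rfl⟩⟩
      obtain ⟨k, w, hw, hwz⟩ := mem_iUnion.1 hy
      obtain rfl : k = j := by
        by_contra hkj
        exact disjoint_left.1 (hWd hkj) w.2 (hwz ▸ z.2)
      obtain rfl : w = z := Subtype.ext hwz
      exact ⟨w, hw, hz⟩
    · intro x hx
      obtain ⟨j, w, hw, rfl⟩ := mem_iUnion.1 hx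
      exact hts j a hw

/-- An open set partitioned into open `σ`-compact sets is paracompact. -/
theorem paracompactSpace_of_pairwise_disjoint_isSigmaCompact {Z ι : Type*} [TopologicalSpace Z]
    [LocallyCompactSpace Z] [T2Space Z] {G : Set Z} {W : ι → Set Z} (hWo : ∀ j, IsOpen (W j))
    (hWd : Pairwise fun j k ↦ Disjoint (W j) (W k)) (hWu : ⋃ j, W j = G)
    (hW : ∀ j, IsSigmaCompact (W j)) : ParacompactSpace G := by
  refine ParacompactSpace.of_pairwise_disjoint_isOpen
    (W := fun j ↦ (Subtype.val ⁻¹' W j : Set G))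
    (fun j ↦ (hWo j).preimage continuous_subtype_val)
    (fun j k hjk ↦ (hWd hjk).preimage _) ?_ fun j ↦ ?_
  · rw [← preimage_iUnion, hWu, Subtype.coe_preimage_self]
  · have hG : IsOpen G := hWu ▸ isOpen_iUnion hWo
    have := hG.locallyCompactSpace
    have := ((hWo j).preimage (continuous_subtype_val (p := (· ∈ G)))).locallyCompactSpace
    have : IsSigmaCompact (Subtype.val ⁻¹' W j : Set G) := by
      rw [Subtype.isSigmaCompact_iff, Subtype.image_preimage_coe,
        inter_eq_right.2 (hWu ▸ subset_iUnion W j)]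
      exact hW j
    have := isSigmaCompact_iff_sigmaCompactSpace.1 this
    infer_instance

theorem IsOpen.exists_iUnion_isClosed_of_metrizable {K : Type*} [TopologicalSpace K]
    [MetrizableSpace K] {O : Set K} (hO : IsOpen O) :
    ∃ C : ℕ → Set K, (∀ n, IsClosed (C n)) ∧ ⋃ n, C n = O := by
  let := metrizableSpaceMetric K
  obtain ⟨C, hC, -, hCO, -⟩ := hO.exists_iUnion_isClosed
  exact ⟨C, hC, hCO⟩

theorem isOpen_preimage_of_isOpen_preimage_frontier {K Y : Type*} [TopologicalSpace K]
    [TopologicalSpace Y] {f : Y → K}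
    (hf : Continuous f) {F : Set K} (hF : IsClosed F) (h : IsOpen (f ⁻¹' frontier F)) :
    IsOpen (f ⁻¹' F) := by
  rw [← hF.closure_eq, closure_eq_interior_union_frontier, preimage_union]
  exact (isOpen_interior.preimage hf).union h

/-- An open subset of a closed `X ⊆ K × E` lying over one point of `E` is `σ`-compact. -/
theorem IsClosed.isSigmaCompact_of_subset_section {K E : Type*} [TopologicalSpace K]
    [CompactSpace K] [MetrizableSpace K] [TopologicalSpace E] {X : Set (K × E)}
    (hX : IsClosed X) {T : Set X} (hT : IsOpen T)
    (i : E) (hTi : ∀ z ∈ T, z.1.2 = i) : IsSigmaCompact T := by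
  let e : {x : K // (x, i) ∈ X} → X := fun x ↦ ⟨(x.1, i), x.2⟩
  have he : Continuous e := by fun_prop
  have hcl : IsClosed {x : K | (x, i) ∈ X} := hX.preimage (by fun_prop)
  have : CompactSpace {x : K // (x, i) ∈ X} := isCompact_iff_compactSpace.1 hcl.isCompact
  have : MetrizableSpace {x : K // (x, i) ∈ X} := IsEmbedding.subtypeVal.metrizableSpace
  obtain ⟨C, hC, hCT⟩ := (hT.preimage he).exists_iUnion_isClosed_of_metrizable
  have hTe : e '' (e ⁻¹' T) = T := by
    refine image_preimage_eq_of_subset fun z hz ↦ ?_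
    obtain rfl := hTi z hz
    exact ⟨⟨z.1.1, z.2⟩, rfl⟩
  rw [← hTe, ← hCT]
  exact (isSigmaCompact_iUnion_of_isCompact C fun n ↦ (hC n).isCompact).image he

section Product

variable {K : Type*} [TopologicalSpace K] [CompactSpace K] [MetrizableSpace K]
  {D : Type*} [TopologicalSpace D] [DiscreteTopology D] {X : Set (K × OnePoint D)}

theorem IsClosed.countable_setOf_section_not_subset (hX : IsClosed X) {O : Set K}
    (hO : IsOpen O) {U : Set (K × OnePoint D)} (hU : IsOpen U)
    (h : ∀ x ∈ O, (x, (OnePoint.infty : OnePoint D)) ∈ X → (x, OnePoint.infty) ∈ U) :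
    {i : D | ∃ x ∈ O, (x, (i : OnePoint D)) ∈ X ∧ (x, (i : OnePoint D)) ∉ U}.Countable := by
  obtain ⟨C, hC, rfl⟩ := hO.exists_iUnion_isClosed_of_metrizable
  have hfin (n : ℕ) :
      {i : D | ∃ x ∈ C n, (x, (i : OnePoint D)) ∈ X ∧ (x, (i : OnePoint D)) ∉ U}.Finite := by
    let Z : Set (K × OnePoint D) := (Prod.fst ⁻¹' C n ∩ X) \ U
    have hZ : IsCompact Z :=
      ((((hC n).preimage continuous_fst).inter hX).sdiff hU).isCompact
    have hZr : Prod.snd '' Z ⊆ range ((↑) : D → OnePoint D) := by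
      rintro _ ⟨⟨x, i⟩, ⟨⟨hx, hxX⟩, hxU⟩, rfl⟩
      induction i using OnePoint.rec with
      | infty => exact absurd (h x (mem_iUnion.2 ⟨n, hx⟩) hxX) hxU
      | coe i => exact ⟨i, rfl⟩
    have := ((OnePoint.isOpenEmbedding_coe (X := D)).isInducing.isCompact_preimage'
      (hZ.image continuous_snd) hZr).finite_of_discrete
    refine this.subset ?_
    rintro i ⟨x, hx, hxX, hxU⟩
    exact ⟨(x, i), ⟨⟨hx, hxX⟩, hxU⟩, rfl⟩
  refine (countable_iUnion fun n ↦ (hfin n).countable).mono ?_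
  rintro i ⟨x, hx, hi⟩
  obtain ⟨n, hn⟩ := mem_iUnion.1 hx
  exact mem_iUnion.2 ⟨n, x, hn, hi⟩

theorem countable_setOf_not_isOpen_of_normalSpace (hX : IsClosed X)
    (h : ∀ A : Set X, NormalSpace A) {F : Set K} (hF : IsClosed F) :
    {i : D | ¬ IsOpen (Subtype.val ⁻¹' F :
      Set {x : K // (x, (i : OnePoint D)) ∈ X})}.Countable := by
  let A : Set X := {z | ¬ (z.1.2 = OnePoint.infty ∧ z.1.1 ∈ F)}
  have := h A
  let e : A → K × OnePoint D := fun a ↦ a.1.1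
  have he : IsInducing e := IsInducing.subtypeVal.comp IsInducing.subtypeVal
  obtain ⟨U', V', hU', hV', hPU, hQV, hUV⟩ := normal_separation
    (s := {a : A | (e a).2 = OnePoint.infty}) (t := {a : A | (e a).1 ∈ F})
    (OnePoint.isClosed_infty.preimage (continuous_snd.comp he.continuous))
    (hF.preimage (continuous_fst.comp he.continuous))
    (disjoint_left.2 fun a h₁ h₂ ↦ a.2 ⟨h₁, h₂⟩)
  obtain ⟨U, hU, rfl⟩ := he.isOpen_iff.1 hU'
  obtain ⟨V, hV, rfl⟩ := he.isOpen_iff.1 hV'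
  refine (hX.countable_setOf_section_not_subset hF.isOpen_compl hU
    fun x hx hxX ↦ ?_).mono fun i hi ↦ ?_
  · exact hPU (a := ⟨⟨(x, OnePoint.infty), hxX⟩, fun h ↦ hx h.2⟩) rfl
  · by_contra hcon
    have hsub : ∀ x ∉ F, (x, (i : OnePoint D)) ∈ X → (x, (i : OnePoint D)) ∈ U := by
      intro x hx hxX
      by_contra hxU
      exact hcon ⟨x, hx, hxX, hxU⟩
    have hA (x : {x : K // (x, (i : OnePoint D)) ∈ X}) : ⟨(x.1, (i : OnePoint D)), x.2⟩ ∈ A :=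
      fun h ↦ OnePoint.coe_ne_infty i h.1
    apply hi
    have heq : (Subtype.val ⁻¹' F : Set {x : K // (x, (i : OnePoint D)) ∈ X}) =
        (fun x ↦ (x.1, (i : OnePoint D))) ⁻¹' V := by
      ext x
      refine ⟨fun hx ↦ hQV (a := ⟨_, hA x⟩) hx, fun hx ↦ ?_⟩
      by_contra hxF
      exact disjoint_left.1 hUV
        (show (⟨_, hA x⟩ : A) ∈ e ⁻¹' U from hsub x.1 hxF x.2) hx
    rw [heq]
    exact hV.preimage (by fun_prop)

theorem paracompactSpace_of_countable_setOf_not_isOpen (hX : IsClosed X)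
    (h : ∀ F : Set K, IsClosed F → {i : D | ¬ IsOpen (Subtype.val ⁻¹' F :
      Set {x : K // (x, (i : OnePoint D)) ∈ X})}.Countable)
    {G : Set X} (hG : IsOpen G) : ParacompactSpace G := by
  have : CompactSpace X := isCompact_iff_compactSpace.1 hX.isCompact
  obtain ⟨G₀, hG₀, rfl⟩ := isOpen_induced_iff.1 hG
  let F : Set K := {x | (x, (OnePoint.infty : OnePoint D)) ∈ X \ G₀}
  have hF : IsClosed F := (hX.sdiff hG₀).preimage (by fun_prop)
  have hN₁ := hX.countable_setOf_section_not_subset hF.isOpen_compl hG₀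
    fun x hx hxX ↦ by_contra fun hxG ↦ hx ⟨hxX, hxG⟩
  obtain ⟨N, hN, hNF, hNG⟩ : ∃ N : Set D, N.Countable ∧
      (∀ i ∉ N, IsOpen (Subtype.val ⁻¹' F : Set {x : K // (x, (i : OnePoint D)) ∈ X})) ∧
      ∀ i ∉ N, ∀ x ∉ F, (x, (i : OnePoint D)) ∈ X → (x, (i : OnePoint D)) ∈ G₀ := by
    refine ⟨_, (h F hF).union hN₁, fun i hi ↦ ?_, fun i hi x hx hxX ↦ ?_⟩
    · exact by_contra fun hcon ↦ hi (Or.inl hcon)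
    · exact by_contra fun hcon ↦ hi (Or.inr ⟨x, hx, hxX, hcon⟩)
  have hlev (i : D) : IsOpen {z : X | z.1.2 = i} := by
    have : IsOpen ({(i : OnePoint D)} : Set (OnePoint D)) := by
      simpa using OnePoint.isOpenEmbedding_coe.isOpenMap _ (isOpen_discrete ({i} : Set D))
    exact this.preimage (continuous_snd.comp continuous_subtype_val)
  have hfst : Continuous fun z : X ↦ z.1.1 := by fun_prop
  let W : Option D → Set X := fun j ↦ j.elim
    ({z | z.1 ∈ G₀ ∧ z.1.1 ∉ F} ∪ ⋃ i ∈ N, {z | z.1 ∈ G₀ ∧ z.1.2 = i})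
    (fun i ↦ {z | i ∉ N ∧ z.1 ∈ G₀ ∧ z.1.1 ∈ F ∧ z.1.2 = i})
  have hWo : ∀ j, IsOpen (W j) := by
    rintro (_ | i)
    · exact (hG.inter (hF.isOpen_compl.preimage hfst)).union
        (isOpen_biUnion fun i _ ↦ hG.inter (hlev i))
    · by_cases hi : i ∈ N
      · simp [W, hi]
      obtain ⟨V, hV, hVF⟩ := isOpen_induced_iff.1 (hNF i hi)
      have heq : W (some i) =
          {z : X | z.1 ∈ G₀ ∧ z.1.1 ∈ V ∧ z.1.2 = (i : OnePoint D)} := by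
        ext ⟨⟨x, j⟩, hz⟩
        have hx (hxX : (x, (i : OnePoint D)) ∈ X) : x ∈ V ↔ x ∈ F :=
          Set.ext_iff.1 hVF ⟨x, hxX⟩
        constructor
        · rintro ⟨-, hzG, hzF, rfl⟩
          exact ⟨hzG, (hx hz).2 hzF, rfl⟩
        · rintro ⟨hzG, hzF, rfl⟩
          exact ⟨hi, hzG, (hx hz).1 hzF, rfl⟩
      rw [heq]
      exact hG.inter ((hV.preimage hfst).inter (hlev i))
  refine paracompactSpace_of_pairwise_disjoint_isSigmaCompact hWo ?_ ?_ ?_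
  · have hns (i : D) : Disjoint (W none) (W (some i)) := by
      rw [disjoint_left]
      rintro z (⟨-, hz⟩ | hz) ⟨hi, -, hzF, hzi⟩
      · exact hz hzF
      · obtain ⟨k, hk, -, hzk⟩ := mem_iUnion₂.1 hz
        exact hi (OnePoint.coe_injective (hzi.symm.trans hzk) ▸ hk)
    rintro (_ | i) (_ | k) hik
    · exact absurd rfl hik
    · exact hns k
    · exact (hns i).symm
    · rw [disjoint_left]
      rintro z ⟨-, -, -, hzi⟩ ⟨-, -, -, hzk⟩
      exact hik (congrArg some (OnePoint.coe_injective (hzi.symm.trans hzk)))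
  · ext ⟨⟨x, j⟩, hz⟩
    constructor
    · rintro hzW
      obtain ⟨_ | i, hj⟩ := mem_iUnion.1 hzW
      · rcases hj with hj | hj
        · exact hj.1
        · obtain ⟨k, hk, hzk, -⟩ := mem_iUnion₂.1 hj
          exact hzk
      · exact hj.2.1
    · intro hzG
      by_cases hxF : x ∈ F
      · induction j using OnePoint.rec with
        | infty => exact absurd hzG hxF.2
        | coe i =>
          by_cases hi : i ∈ N
          · exact mem_iUnion.2 ⟨none, Or.inr (mem_iUnion₂.2 ⟨i, hi, hzG, rfl⟩)⟩
          · exact mem_iUnion.2 ⟨some i, hi, hzG, hxF, rfl⟩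
      · exact mem_iUnion.2 ⟨none, Or.inl ⟨hzG, hxF⟩⟩
  · rintro (_ | i)
    · obtain ⟨C, hC, hCF⟩ := hF.isOpen_compl.exists_iUnion_isClosed_of_metrizable
      have hNo : IsOpen (⋃ i ∈ N, {z : X | z.1.2 = i}) := isOpen_biUnion fun i _ ↦ hlev i
      have heq : W none = (⋃ n, (fun z : X ↦ z.1.1) ⁻¹' C n \ ⋃ i ∈ N, {z : X | z.1.2 = i}) ∪
          ⋃ i ∈ N, {z | z.1 ∈ G₀ ∧ z.1.2 = i} := by
        rw [← iUnion_sdiff, ← preimage_iUnion, hCF]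
        ext ⟨⟨x, j⟩, hz⟩
        constructor
        · rintro (⟨hzG, hzF⟩ | hz')
          · by_cases hj : ∃ i ∈ N, j = (i : OnePoint D)
            · obtain ⟨i, hi, hji⟩ := hj
              exact Or.inr (mem_iUnion₂.2 ⟨i, hi, hzG, hji⟩)
            · refine Or.inl ⟨hzF, fun hcon ↦ hj ?_⟩
              obtain ⟨i, hi, hji⟩ := mem_iUnion₂.1 hcon
              exact ⟨i, hi, hji⟩
          · exact Or.inr hz'
        · rintro (⟨hzF, hzN⟩ | hz')
          · refine Or.inl ⟨?_, hzF⟩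
            induction j using OnePoint.rec with
            | infty => exact by_contra fun hzG ↦ hzF ⟨hz, hzG⟩
            | coe i => exact hNG i (fun hi ↦ hzN (mem_iUnion₂.2 ⟨i, hi, rfl⟩)) x hzF hz
          · exact Or.inr hz'
      rw [heq, union_eq_iUnion]
      refine isSigmaCompact_iUnion _ (Bool.forall_bool.2 ⟨?_, ?_⟩)
      · exact isSigmaCompact_biUnion hN fun i _ ↦
          hX.isSigmaCompact_of_subset_section (hG.inter (hlev i)) i fun z hz ↦ hz.2
      · exact isSigmaCompact_iUnion_of_isCompact _ fun n ↦
          (((hC n).preimage hfst).sdiff hNo).isCompact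
    · exact hX.isSigmaCompact_of_subset_section (hWo (some i)) i fun z hz ↦ hz.2.2.2

end Product

/-- For a compact metrizable space `K`, a discrete space `D` and a closed subspace
`X ⊆ K × αD`, the following are equivalent: (1) `X` is hereditarily paracompact;
(2) `X` is hereditarily normal; (3) the indexed family of sections `{X_i : i ∈ D}`
is weakly nwd-countable in `K`, i.e. for each closed nowhere dense `F ⊆ K` the set of
indices `i` for which `X_i ∩ F` is not open in the subspace `X_i` is at most countable. -/
theorem hereditarily_paracompact_iff_hereditarily_normal_iff_weakly_nwd_countable
    (K : Type u) [TopologicalSpace K] [CompactSpace K] [TopologicalSpace.MetrizableSpace K]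
    (D : Type v) [TopologicalSpace D] [DiscreteTopology D]
    (X : Set (K × OnePoint D)) (hX : IsClosed X) :
    ((∀ A : Set X, ParacompactSpace A) ↔ (∀ A : Set X, NormalSpace A)) ∧
    ((∀ A : Set X, ParacompactSpace A) ↔
      (∀ F : Set K, IsClosed F → IsNowhereDense F →
        {i : D | ¬ IsOpen (Subtype.val ⁻¹' F :
          Set {x : K // (x, (i : OnePoint D)) ∈ X})}.Countable)) := by
  have hnormal : (∀ A : Set X, ParacompactSpace A) → ∀ A : Set X, NormalSpace A := by
    intro h A
    have := h A
    infer_instance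
  have hparacompact (h : ∀ F : Set K, IsClosed F → IsNowhereDense F →
      {i : D | ¬ IsOpen (Subtype.val ⁻¹' F :
        Set {x : K // (x, (i : OnePoint D)) ∈ X})}.Countable) :
      ∀ A : Set X, ParacompactSpace A := by
    refine paracompactSpace_subtype_of_forall_isOpen fun G hG ↦
      paracompactSpace_of_countable_setOf_not_isOpen hX (fun F hF ↦ ?_) hG
    refine (h (frontier F) isClosed_frontier ?_).mono fun i hi ↦ ?_
    · rw [IsNowhereDense, isClosed_frontier.closure_eq, interior_frontier hF]
    · exact fun hcon ↦ hi
        (isOpen_preimage_of_isOpen_preimage_frontier continuous_subtype_val hF hcon)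
  have hcountable (h : ∀ A : Set X, NormalSpace A) (F : Set K) (hF : IsClosed F)
      (_ : IsNowhereDense F) := countable_setOf_not_isOpen_of_normalSpace hX h hF
  exact ⟨⟨hnormal, fun h ↦ hparacompact (hcountable h)⟩, fun h ↦ hcountable (hnormal h), hparacompact⟩
end

section
/- Let K be a compact metrizable space, D a discrete space, and X ⊆ K × αD a closed subspace. Then X is first countable if and only if the indexed family of sections {X_i : i ∈ D} is point-countable. -/
open Set Topology TopologicalSpace

universe u v

/-- A continuous map from a compact space to a Hausdorff space pulls the neighborhood filter
of `f p` back to that of `p` as soon as `p` is the only point of its fiber. -/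
theorem nhds_eq_comap_of_fiber_subsingleton {X Y : Type*} [TopologicalSpace X] [CompactSpace X]
    [TopologicalSpace Y] [T2Space Y] {f : X → Y} (hf : Continuous f) {p : X}
    (hp : ∀ q, f q = f p → q = p) : 𝓝 p = Filter.comap f (𝓝 (f p)) := by
  have hfiber : f ⁻¹' {f p} = {p} := by
    ext q
    exact ⟨hp q, congrArg f⟩
  rw [hf.isClosedMap.comap_nhds_eq hf, hfiber, nhdsSet_singleton]

/-- The indicator function of a point of a discrete space is continuous on the one-point
compactification. -/
theorem OnePoint.continuous_decide_eq_coe {D : Type*} [TopologicalSpace D] [DiscreteTopology D]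
    [DecidableEq (OnePoint D)] (d : D) :
    Continuous fun i : OnePoint D => decide (i = d) := by
  have hd : IsClopen ({(d : OnePoint D)} : Set (OnePoint D)) := by
    refine ⟨isClosed_singleton, ?_⟩
    rw [← image_singleton, OnePoint.isOpen_image_coe]
    exact isOpen_discrete _
  rw [continuous_bool_rng true]
  convert hd
  ext i
  simp

/-- For a compact metrizable space `K`, a discrete space `D` and a closed subspace
`X ⊆ K × αD`: the space `X` is first countable if and only if the indexed family of
sections `{X_i : i ∈ D}` is point-countable, i.e. for every point `x ∈ K` the set
`{i ∈ D : x ∈ X_i}` is at most countable. -/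
theorem first_countable_iff_point_countable
    (K : Type u) [TopologicalSpace K] [CompactSpace K] [TopologicalSpace.MetrizableSpace K]
    (D : Type v) [TopologicalSpace D] [DiscreteTopology D]
    (X : Set (K × OnePoint D)) (hX : IsClosed X) :
    FirstCountableTopology X ↔
      ∀ x : K, {i : D | (x, (i : OnePoint D)) ∈ X}.Countable := by
  classical
  constructor
  · intro hfc x
    by_cases hfin : {i : D | (x, (i : OnePoint D)) ∈ X}.Finite
    · exact hfin.countable
    have : Infinite {i : D | (x, (i : OnePoint D)) ∈ X} := infinite_coe_iff.2 hfin
    have hlim : Filter.Tendsto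
        (fun i : {i : D | (x, (i : OnePoint D)) ∈ X} => (x, ((i : D) : OnePoint D)))
        Filter.cofinite (𝓝 (x, OnePoint.infty)) := by
      refine tendsto_const_nhds.prodMk_nhds (OnePoint.tendsto_coe_infty.comp ?_)
      rw [Filter.coclosedCompact_eq_cocompact, Filter.cocompact_eq_cofinite]
      exact Subtype.val_injective.tendsto_cofinite
    have hmem : (x, OnePoint.infty) ∈ X :=
      hX.mem_of_tendsto hlim (Filter.Eventually.of_forall fun i => i.2)
    have hlim' : Filter.Tendsto
        (fun i : {i : D | (x, (i : OnePoint D)) ∈ X} => (⟨_, i.2⟩ : X))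
        Filter.cofinite (𝓝 ⟨_, hmem⟩) := tendsto_subtype_rng.2 hlim
    have hcount := hlim'.countable_compl_preimage_ker
    rw [ker_nhds] at hcount
    rw [← countable_coe_iff, ← countable_univ_iff]
    refine hcount.mono ?_
    intro i _ hi
    simp at hi
  · intro hcount
    refine ⟨?_⟩
    rintro ⟨⟨x, i⟩, hp⟩
    induction i using OnePoint.rec with
    | coe d =>
      rw [nhds_subtype, nhds_prod_eq, OnePoint.nhds_coe_eq, nhds_discrete D]
      infer_instance
    | infty =>
      have : CompactSpace X := isCompact_iff_compactSpace.1 hX.isCompact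
      have : Countable {i : D | (x, (i : OnePoint D)) ∈ X} := (hcount x).to_subtype
      let f : X → K × ({i : D | (x, (i : OnePoint D)) ∈ X} → Bool) :=
        fun q => (q.1.1, fun a => decide (q.1.2 = (a : D)))
      have hf : Continuous f :=
        (continuous_fst.comp continuous_subtype_val).prodMk <| continuous_pi fun a =>
          (OnePoint.continuous_decide_eq_coe (a : D)).comp
            (continuous_snd.comp continuous_subtype_val)
      rw [nhds_eq_comap_of_fiber_subsingleton hf]
      · infer_instance
      · rintro ⟨⟨y, j⟩, hq⟩ heq
        obtain rfl : y = x := congrArg Prod.fst heq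
        induction j using OnePoint.rec with
        | infty => rfl
        | coe d =>
          have := congrFun (congrArg Prod.snd heq) ⟨d, hq⟩
          simp [f] at this
end
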